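/- arXiv:1311.2491 — 3 statements merged into one kernel-verified Lean document; each statement's English description precedes it below -/
import Mathlib

section
/- Let f : [1,∞) → ℝ be non-negative and non-decreasing, and let F(x) = Σ_{n ≤ x} f(x/n) (sum over positive integers n ≤ x). If there exist real constants A, B, C such that F(x) = A·x·log x + B·x + C·x/log x + o(x/log x) as x → ∞, then f(x) = A·x + o(x), i.e. f(x)/x → A as x → ∞. -/
open Filter Real Finset
open MeasureTheory
open scoped SchwartzMap FourierTransform Topology ContDiff

theorem summable_inv_mul_inv_one_add_sq_log :
    Summable fun n : ℕ => (n : ℝ)⁻¹ * (1 + (Real.log n) ^ 2)⁻¹ := by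
  rw [← summable_condensed_iff_of_nonneg (fun n => by positivity)]
  · have hs : Summable fun k : ℕ => (Real.log 2 ^ 2)⁻¹ * (1 / (k : ℝ) ^ 2) :=
      (Real.summable_one_div_nat_pow.mpr one_lt_two).mul_left _
    refine hs.of_norm_bounded_eventually_nat ?_
    filter_upwards [eventually_ge_atTop 1] with k hk
    have hk' : (0 : ℝ) < k := by exact_mod_cast hk
    have hl : 0 < Real.log 2 := Real.log_pos one_lt_two
    rw [Real.norm_of_nonneg (by positivity)]
    push_cast
    rw [Real.log_pow, ← mul_assoc, mul_inv_cancel₀ (by positivity), one_mul, one_div, ← mul_inv]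
    apply inv_anti₀ (by positivity)
    nlinarith
  · intro m n hm hmn
    have hm' : (1 : ℝ) ≤ m := by exact_mod_cast hm
    have hmn' : (m : ℝ) ≤ n := by exact_mod_cast hmn
    have := Real.log_nonneg hm'
    gcongr

theorem summable_inv_mul_inv_one_add_sq_sub_log (w : ℝ) :
    Summable fun n : ℕ => (n : ℝ)⁻¹ * (1 + (w - Real.log n) ^ 2)⁻¹ := by
  refine (summable_inv_mul_inv_one_add_sq_log.mul_left (2 * (1 + w ^ 2))).of_nonneg_of_le
    (fun n => by positivity) fun n => ?_
  have h : (1 + (w - Real.log n) ^ 2)⁻¹ ≤ 2 * (1 + w ^ 2) * (1 + (Real.log n) ^ 2)⁻¹ := by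
    rw [← div_eq_mul_inv, inv_le_comm₀ (by positivity) (by positivity), inv_div,
      div_le_iff₀ (by positivity)]
    nlinarith [sq_nonneg (w + (w - Real.log n)), sq_nonneg (w * (w - Real.log n))]
  calc (n : ℝ)⁻¹ * (1 + (w - Real.log n) ^ 2)⁻¹
      ≤ (n : ℝ)⁻¹ * (2 * (1 + w ^ 2) * (1 + (Real.log n) ^ 2)⁻¹) := by gcongr
    _ = _ := by ring

theorem SchwartzMap.exists_norm_le_inv_one_add_sq_sq (ψ : 𝓢(ℝ, ℂ)) :
    ∃ C, 0 ≤ C ∧ ∀ y, ‖ψ y‖ ≤ C * ((1 + y ^ 2)⁻¹ * (1 + y ^ 2)⁻¹) := by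
  obtain ⟨C₀, hC₀, h₀⟩ := ψ.decay 0 0
  obtain ⟨C₄, hC₄, h₄⟩ := ψ.decay 4 0
  refine ⟨2 * (C₀ + C₄), by positivity, fun y => ?_⟩
  have h0 := h₀ y
  have h4 := h₄ y
  simp only [pow_zero, one_mul, norm_iteratedFDeriv_zero, Real.norm_eq_abs] at h0 h4
  rw [Even.pow_abs (by decide)] at h4
  rw [← mul_inv, ← div_eq_mul_inv, le_div_iff₀ (by positivity)]
  nlinarith [norm_nonneg (ψ y), mul_nonneg (norm_nonneg (ψ y)) (sq_nonneg (y ^ 2 - 1))]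

theorem riemannZeta₁_ne_zero_of_one_le_re {s : ℂ} (hs : 1 ≤ s.re) : riemannZeta₁ s ≠ 0 := by
  by_cases h : s = 1
  · simp [h]
  · intro h0
    exact riemannZeta_ne_zero_of_one_le_re hs (by rw [riemannZeta_eq_inv_sub_mul h, h0, mul_zero])

/-- The quotient of a compactly supported Schwartz function by `v ↦ ζ (1 - 2πiv)`. -/
theorem exists_schwartz_div_riemannZeta (m : 𝓢(ℝ, ℂ)) (hm : HasCompactSupport m) :
    ∃ p : 𝓢(ℝ, ℂ), ∀ v : ℝ, p v =
      m v * (-(2 * π * v * Complex.I) / riemannZeta₁ (1 - 2 * π * v * Complex.I)) := by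
  have hz : ContDiff ℝ ∞ fun v : ℝ => riemannZeta₁ (1 - 2 * π * v * Complex.I) := by
    have h1 : ContDiff ℝ ∞ riemannZeta₁ :=
      (differentiable_riemannZeta₁.contDiff (n := ∞)).restrict_scalars ℝ
    have h2 : ContDiff ℝ ∞ fun v : ℝ => (1 - 2 * π * (v : ℂ) * Complex.I) := by
      have : ContDiff ℝ ∞ fun v : ℝ => (v : ℂ) := Complex.ofRealCLM.contDiff
      fun_prop
    exact h1.comp h2
  have hq : ContDiff ℝ ∞ fun v : ℝ =>
      -(2 * π * (v : ℂ) * Complex.I) / riemannZeta₁ (1 - 2 * π * v * Complex.I) := by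
    have h2 : ContDiff ℝ ∞ fun v : ℝ => -(2 * π * (v : ℂ) * Complex.I) := by
      have : ContDiff ℝ ∞ fun v : ℝ => (v : ℂ) := Complex.ofRealCLM.contDiff
      fun_prop
    simp_rw [div_eq_mul_inv]
    exact h2.mul (hz.inv fun v => riemannZeta₁_ne_zero_of_one_le_re (by simp))
  exact ⟨(hm.mul_right (f' := fun v : ℝ => -(2 * π * (v : ℂ) * Complex.I) /
    riemannZeta₁ (1 - 2 * π * v * Complex.I))).toSchwartzMap ((m.smooth ⊤).mul hq), fun v => rfl⟩

theorem ofReal_rpow_mul_fourierChar (n : ℕ) {ε : ℝ} (hε : 0 < ε) (v w : ℝ) :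
    (((n : ℝ) ^ (-(1 + ε)) : ℝ) : ℂ) * (𝐞 (-(v * (w - Real.log n))) : ℂ) =
      (𝐞 (-(v * w)) : ℂ) * (1 / (n : ℂ) ^ (1 + ε - 2 * π * v * Complex.I)) := by
  have hre : (1 + (ε : ℂ) - 2 * π * v * Complex.I) ≠ 0 := by
    intro h
    have := congrArg Complex.re h
    simp at this
    linarith
  rcases Nat.eq_zero_or_pos n with rfl | hn
  · have : -(1 + ε) ≠ 0 := by linarith
    rw [Nat.cast_zero, Real.zero_rpow this, Nat.cast_zero, Complex.zero_cpow hre]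
    simp
  · have hn' : (n : ℂ) ≠ 0 := by exact_mod_cast hn.ne'
    have hn'' : (0 : ℝ) < n := by exact_mod_cast hn
    rw [one_div, ← Complex.cpow_neg, Complex.cpow_def_of_ne_zero hn', Real.fourierChar_apply,
      Real.fourierChar_apply, Real.rpow_def_of_pos hn'', Complex.ofReal_exp, ← Complex.exp_add,
      ← Complex.exp_add, ← Complex.natCast_log]
    congr 1
    push_cast
    ring

theorem tsum_rpow_mul_fourier (p : 𝓢(ℝ, ℂ)) (w : ℝ) {ε : ℝ} (hε : 0 < ε) :
    ∑' n : ℕ, (((n : ℝ) ^ (-(1 + ε)) : ℝ) : ℂ) * (𝓕 p) (w - Real.log n) =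
      ∫ v : ℝ, (𝐞 (-(v * w)) : ℂ) * (p v * riemannZeta (1 + ε - 2 * π * v * Complex.I)) := by
  have hint (n : ℕ) : Integrable fun v : ℝ => (((n : ℝ) ^ (-(1 + ε)) : ℝ) : ℂ) *
      ((𝐞 (-(v * (w - Real.log n))) : ℂ) * p v) := by
    refine Integrable.const_mul ?_ _
    refine p.integrable.mono ?_ ?_
    · apply Continuous.aestronglyMeasurable
      have := p.continuous
      fun_prop
    · filter_upwards with v
      rw [norm_mul, Circle.norm_coe, one_mul]
  have hnorm (n : ℕ) : ∫ v : ℝ, ‖(((n : ℝ) ^ (-(1 + ε)) : ℝ) : ℂ) *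
      ((𝐞 (-(v * (w - Real.log n))) : ℂ) * p v)‖ = (n : ℝ) ^ (-(1 + ε)) * ∫ v, ‖p v‖ := by
    rw [← integral_const_mul]
    congr 1
    ext v
    have : (0 : ℝ) ≤ (n : ℝ) ^ (-(1 + ε)) := by positivity
    simp only [norm_mul, Circle.norm_coe, one_mul, Complex.norm_real, Real.norm_of_nonneg this]
  have hsum := integral_tsum_of_summable_integral_norm hint (by
    simp_rw [hnorm]
    exact (Real.summable_nat_rpow.mpr (by linarith)).mul_right _)
  have h1 (n : ℕ) : (((n : ℝ) ^ (-(1 + ε)) : ℝ) : ℂ) * (𝓕 p) (w - Real.log n) =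
      ∫ v : ℝ, (((n : ℝ) ^ (-(1 + ε)) : ℝ) : ℂ) *
        ((𝐞 (-(v * (w - Real.log n))) : ℂ) * p v) := by
    rw [integral_const_mul, SchwartzMap.fourier_coe, Real.fourier_real_eq]
    rfl
  simp_rw [h1]
  rw [hsum]
  congr 1
  ext v
  rw [zeta_eq_tsum_one_div_nat_cpow (by simpa using hε)]
  rw [← tsum_mul_left, ← tsum_mul_left]
  refine tsum_congr fun n => ?_
  rw [← mul_assoc, ofReal_rpow_mul_fourierChar n hε v w]
  ring

theorem norm_div_riemannZeta_mul_riemannZeta_le {ε v : ℝ} (hε : 0 < ε) :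
    ‖(-(2 * π * v * Complex.I) / riemannZeta₁ (1 - 2 * π * v * Complex.I)) *
      riemannZeta (1 + ε - 2 * π * v * Complex.I)‖ ≤
    ‖riemannZeta₁ (1 + ε - 2 * π * v * Complex.I) / riemannZeta₁ (1 - 2 * π * v * Complex.I)‖ := by
  have hs : (1 + (ε : ℂ) - 2 * π * v * Complex.I) ≠ 1 := by
    intro h
    have := congrArg Complex.re h
    simp at this
    linarith
  have hs' : 0 < ‖(1 + (ε : ℂ) - 2 * π * v * Complex.I) - 1‖ := by
    rw [norm_pos_iff]; exact sub_ne_zero.mpr hs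
  have h1 : ‖-(2 * π * v * Complex.I)‖ ≤ ‖(1 + (ε : ℂ) - 2 * π * v * Complex.I) - 1‖ := by
    have := Complex.abs_im_le_norm ((1 + (ε : ℂ) - 2 * π * v * Complex.I) - 1)
    simpa [abs_mul] using this
  rw [riemannZeta_eq_inv_sub_mul hs, norm_mul, norm_mul, norm_div, norm_div, norm_inv]
  calc _ = ‖-(2 * π * v * Complex.I)‖ * ‖(1 + (ε : ℂ) - 2 * π * v * Complex.I) - 1‖⁻¹ *
      (‖riemannZeta₁ (1 + ε - 2 * π * v * Complex.I)‖ /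
        ‖riemannZeta₁ (1 - 2 * π * v * Complex.I)‖) := by ring
    _ ≤ 1 * _ := by
      gcongr
      rw [← div_eq_mul_inv]
      exact div_le_one_of_le₀ h1 hs'.le
    _ = _ := one_mul _

theorem tendsto_integral_mul_riemannZeta (m p : 𝓢(ℝ, ℂ)) (hm : HasCompactSupport m)
    (hp : ∀ v : ℝ, p v =
      m v * (-(2 * π * v * Complex.I) / riemannZeta₁ (1 - 2 * π * v * Complex.I))) (w : ℝ) :
    Tendsto (fun ε : ℝ => ∫ v : ℝ, (𝐞 (-(v * w)) : ℂ) *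
      (p v * riemannZeta (1 + ε - 2 * π * v * Complex.I))) (𝓝[>] 0) (𝓝 ((𝓕 m) w)) := by
  have hcont : Continuous fun z : ℝ × ℝ => riemannZeta₁ (1 + z.1 - 2 * π * z.2 * Complex.I) /
      riemannZeta₁ (1 - 2 * π * z.2 * Complex.I) := by
    have := differentiable_riemannZeta₁.continuous
    exact Continuous.div (by fun_prop) (by fun_prop) fun z =>
      riemannZeta₁_ne_zero_of_one_le_re (by simp)
  obtain ⟨D, hD⟩ := ((isCompact_Icc (a := (0 : ℝ)) (b := 1)).prod hm).exists_bound_of_continuousOn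
    hcont.continuousOn
  have hF : (𝓕 m) w = ∫ v : ℝ, (𝐞 (-(v * w)) : ℂ) * m v := by
    rw [SchwartzMap.fourier_coe, Real.fourier_real_eq]
    rfl
  rw [hF]
  apply tendsto_integral_filter_of_dominated_convergence (fun v => D * ‖m v‖)
  · filter_upwards [self_mem_nhdsWithin] with ε hε
    apply Continuous.aestronglyMeasurable
    have hc : Continuous fun v : ℝ => riemannZeta (1 + ε - 2 * π * v * Complex.I) := by
      rw [continuous_iff_continuousAt]
      intro v
      have : ContinuousAt riemannZeta (1 + ε - 2 * π * v * Complex.I) := by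
        refine (differentiableAt_riemannZeta ?_).continuousAt
        intro h
        have := congrArg Complex.re h
        simp at this
        exact hε.ne' this
      exact ContinuousAt.comp (f := fun v : ℝ => (1 + ε - 2 * π * v * Complex.I : ℂ)) this
        (by fun_prop)
    have := p.continuous
    fun_prop
  · filter_upwards [self_mem_nhdsWithin, mem_nhdsWithin_of_mem_nhds (Iic_mem_nhds one_pos)]
      with ε hε hε1
    filter_upwards with v
    by_cases hv : v ∈ tsupport m
    · have h1 := hD (ε, v) ⟨⟨le_of_lt hε, hε1⟩, hv⟩
      rw [norm_mul, Circle.norm_coe, one_mul, hp, mul_assoc, norm_mul, mul_comm]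
      gcongr
      exact (norm_div_riemannZeta_mul_riemannZeta_le hε).trans h1
    · simp [hp, image_eq_zero_of_notMem_tsupport hv]
  · exact m.integrable.norm.const_mul D
  · have h0 : ∀ᵐ v : ℝ, v ≠ 0 := by simp [ae_iff]
    filter_upwards [h0] with v hv
    have hs : (1 + ((0 : ℝ) : ℂ) - 2 * π * v * Complex.I) ≠ 1 := by
      intro h
      have := congrArg Complex.im h
      simp [hv, Real.pi_ne_zero] at this
    have hlim : Tendsto (fun ε : ℝ => riemannZeta (1 + ε - 2 * π * v * Complex.I)) (𝓝 0)
        (𝓝 (riemannZeta (1 + ((0 : ℝ) : ℂ) - 2 * π * v * Complex.I))) := by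
      have := (differentiableAt_riemannZeta hs).continuousAt
      exact ContinuousAt.tendsto (ContinuousAt.comp
        (f := fun ε : ℝ => (1 + ε - 2 * π * v * Complex.I : ℂ)) this (by fun_prop))
    have h2 : m v = p v * riemannZeta (1 + ((0 : ℝ) : ℂ) - 2 * π * v * Complex.I) := by
      have h3 : riemannZeta₁ (1 - 2 * π * v * Complex.I) ≠ 0 :=
        riemannZeta₁_ne_zero_of_one_le_re (by simp)
      have h4 : (v : ℂ) ≠ 0 := by exact_mod_cast hv
      have h5 : (π : ℂ) ≠ 0 := by exact_mod_cast Real.pi_ne_zero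
      rw [riemannZeta_eq_inv_sub_mul hs, hp]
      simp only [Complex.ofReal_zero, add_zero]
      have h6 : (1 - 2 * π * v * Complex.I : ℂ) - 1 = -(2 * π * v * Complex.I) := by ring
      have h7 : -(2 * π * v * Complex.I : ℂ) ≠ 0 := by simp [h4, h5]
      rw [h6]
      field_simp
    have h8 := ((hlim.mono_left
      (nhdsWithin_le_nhds (s := Set.Ioi 0))).const_mul (p v)).const_mul (𝐞 (-(v * w)) : ℂ)
    rwa [← h2] at h8

theorem hasSum_fourier_of_eq_mul_div_riemannZeta (m p : 𝓢(ℝ, ℂ)) (hm : HasCompactSupport m)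
    (hp : ∀ v : ℝ, p v =
      m v * (-(2 * π * v * Complex.I) / riemannZeta₁ (1 - 2 * π * v * Complex.I))) (w : ℝ) :
    HasSum (fun n : ℕ => (((n : ℝ)⁻¹ : ℝ) : ℂ) * (𝓕 p) (w - Real.log n)) ((𝓕 m) w) := by
  obtain ⟨C, hC, hbd⟩ := (𝓕 p).exists_norm_le_inv_one_add_sq_sq
  have hsum : Summable fun n : ℕ => C * ((n : ℝ)⁻¹ * (1 + (w - Real.log n) ^ 2)⁻¹) :=
    (summable_inv_mul_inv_one_add_sq_sub_log w).mul_left C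
  have hbd' (n : ℕ) : (n : ℝ)⁻¹ * ‖(𝓕 p) (w - Real.log n)‖ ≤
      C * ((n : ℝ)⁻¹ * (1 + (w - Real.log n) ^ 2)⁻¹) := by
    have h1 : (1 + (w - Real.log n) ^ 2)⁻¹ ≤ 1 :=
      inv_le_one_of_one_le₀ (by nlinarith [sq_nonneg (w - Real.log n)])
    calc (n : ℝ)⁻¹ * ‖(𝓕 p) (w - Real.log n)‖ ≤ (n : ℝ)⁻¹ *
          (C * ((1 + (w - Real.log n) ^ 2)⁻¹ * 1)) := by
          gcongr
          refine (hbd _).trans ?_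
          gcongr
      _ = _ := by ring
  have hS : Summable fun n : ℕ => (((n : ℝ)⁻¹ : ℝ) : ℂ) * (𝓕 p) (w - Real.log n) := by
    refine hsum.of_norm_bounded fun n => ?_
    rw [norm_mul, Complex.norm_real, Real.norm_of_nonneg (by positivity)]
    exact hbd' n
  have hlim : Tendsto (fun ε : ℝ => ∑' n : ℕ, (((n : ℝ) ^ (-(1 + ε)) : ℝ) : ℂ) *
      (𝓕 p) (w - Real.log n)) (𝓝[>] 0)
      (𝓝 (∑' n : ℕ, (((n : ℝ)⁻¹ : ℝ) : ℂ) * (𝓕 p) (w - Real.log n))) := by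
    apply tendsto_tsum_of_dominated_convergence hsum
    · intro n
      refine Tendsto.mul_const _ ?_
      refine (Complex.continuous_ofReal.tendsto _).comp ?_
      refine Tendsto.mono_left ?_ nhdsWithin_le_nhds
      rcases Nat.eq_zero_or_pos n with rfl | hn
      · have : ∀ᶠ ε : ℝ in 𝓝 0, -1 < ε := Ioi_mem_nhds (by norm_num)
        refine Tendsto.congr' ?_ tendsto_const_nhds
        filter_upwards [this] with ε hε
        have : -(1 + ε) ≠ 0 := by linarith
        rw [Nat.cast_zero, Real.zero_rpow this]
        simp
      · have hn' : (n : ℝ) ≠ 0 := by exact_mod_cast hn.ne'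
        have : ContinuousAt (fun ε : ℝ => (n : ℝ) ^ (-(1 + ε))) 0 := by
          exact ContinuousAt.rpow continuousAt_const (by fun_prop) (Or.inl hn')
        have h2 := this.tendsto
        simpa [Real.rpow_neg_one] using h2
    · filter_upwards [self_mem_nhdsWithin] with ε hε n
      rw [norm_mul, Complex.norm_real, Real.norm_of_nonneg (by positivity)]
      refine le_trans ?_ (hbd' n)
      gcongr
      rcases Nat.eq_zero_or_pos n with rfl | hn
      · have hε' : (0 : ℝ) < ε := hε
        have : -(1 + ε) ≠ 0 := by linarith
        rw [Nat.cast_zero, Real.zero_rpow this]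
        simp
      · rw [← Real.rpow_neg_one]
        have hε' : (0 : ℝ) < ε := hε
        exact Real.rpow_le_rpow_of_exponent_le (by exact_mod_cast hn) (by linarith)
  have hlim2 := (tendsto_integral_mul_riemannZeta m p hm hp w).congr' (by
    filter_upwards [self_mem_nhdsWithin] with ε hε
    exact (tsum_rpow_mul_fourier p w hε).symm)
  rw [tendsto_nhds_unique hlim2 hlim]
  exact hS.hasSum
theorem summable_integral_norm_mul_sub_log (ψ : 𝓢(ℝ, ℂ)) {h : ℝ → ℝ} {M : ℝ}
    (hmeas : Measurable h) (hM : ∀ u, |h u| ≤ M) (h0 : ∀ u < 0, h u = 0) (u : ℝ) :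
    (∀ n : ℕ, Integrable fun v : ℝ => ((n : ℝ)⁻¹ : ℂ) * ψ (u - v - Real.log n) * h v) ∧
    Summable fun n : ℕ => ∫ v : ℝ, ‖((n : ℝ)⁻¹ : ℂ) * ψ (u - v - Real.log n) * h v‖ := by
  obtain ⟨C, hC, hbd⟩ := ψ.exists_norm_le_inv_one_add_sq_sq
  have hM0 : 0 ≤ M := (abs_nonneg _).trans (hM 0)
  have hbound (n : ℕ) (v : ℝ) : ‖((n : ℝ)⁻¹ : ℂ) * ψ (u - v - Real.log n) * h v‖ ≤
      (C * M * (1 + u ^ 2)) * ((n : ℝ)⁻¹ * (1 + (u - Real.log n) ^ 2)⁻¹) *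
        (1 + (u - Real.log n - v) ^ 2)⁻¹ := by
    rw [norm_mul, norm_mul, ← Complex.ofReal_inv, Complex.norm_real, Complex.norm_real,
      Real.norm_of_nonneg (by positivity), Real.norm_eq_abs]
    rcases lt_or_ge v 0 with hv | hv
    · rw [h0 v hv, abs_zero, mul_zero]
      positivity
    have hl : 0 ≤ Real.log n := Real.log_natCast_nonneg n
    have h1 : (1 + (u - Real.log n - v) ^ 2)⁻¹ ≤
        (1 + u ^ 2) * (1 + (u - Real.log n) ^ 2)⁻¹ := by
      rw [← div_eq_mul_inv, inv_le_comm₀ (by positivity) (by positivity), inv_div,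
        div_le_iff₀ (by positivity)]
      rcases le_total (u - Real.log n) 0 with ha | ha
      · nlinarith [mul_nonneg (sq_nonneg u) (sq_nonneg (u - Real.log n - v)), sq_nonneg u]
      · nlinarith [mul_nonneg (sq_nonneg u) (sq_nonneg (u - Real.log n - v)),
          sq_nonneg (u - Real.log n - v)]
    have h2 := hbd (u - Real.log n - v)
    rw [show u - v - Real.log n = u - Real.log n - v by ring]
    calc (n : ℝ)⁻¹ * ‖ψ (u - Real.log n - v)‖ * |h v| ≤
        (n : ℝ)⁻¹ * (C * (((1 + u ^ 2) * (1 + (u - Real.log n) ^ 2)⁻¹) *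
          (1 + (u - Real.log n - v) ^ 2)⁻¹)) * M := by
          gcongr
          · exact h2.trans (by gcongr)
          · exact hM v
      _ = _ := by ring
  have hI (a : ℝ) : Integrable fun v : ℝ => (1 + (a - v) ^ 2)⁻¹ :=
    integrable_inv_one_add_sq.comp_sub_left a
  have hint (n : ℕ) :
      Integrable fun v : ℝ => ((n : ℝ)⁻¹ : ℂ) * ψ (u - v - Real.log n) * h v := by
    refine ((hI (u - Real.log n)).const_mul _).mono' ?_ (Eventually.of_forall (hbound n))
    have h1 : Measurable fun v : ℝ => ψ (u - v - Real.log n) := by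
      have := ψ.continuous
      exact Continuous.measurable (by fun_prop)
    have h2 : Measurable fun v : ℝ => (h v : ℂ) := Complex.measurable_ofReal.comp hmeas
    exact ((h1.const_mul _).mul h2).aestronglyMeasurable
  refine ⟨hint, Summable.of_nonneg_of_le (fun n => integral_nonneg fun v => norm_nonneg _)
    (fun n => ?_) (((summable_inv_mul_inv_one_add_sq_sub_log u).mul_left
      (C * M * (1 + u ^ 2))).mul_right π)⟩
  calc _ ≤ ∫ v : ℝ, (C * M * (1 + u ^ 2)) * ((n : ℝ)⁻¹ * (1 + (u - Real.log n) ^ 2)⁻¹) *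
        (1 + (u - Real.log n - v) ^ 2)⁻¹ :=
        integral_mono (hint n).norm ((hI _).const_mul _) (hbound n)
    _ = _ := by
      rw [integral_const_mul, integral_sub_left_eq_self (fun v : ℝ => (1 + v ^ 2)⁻¹),
        integral_univ_inv_one_add_sq]

theorem integral_mul_eq_integral_mul_tsum (φ : ℝ → ℂ) (ψ : 𝓢(ℝ, ℂ))
    (hφ : ∀ w, HasSum (fun n : ℕ => (((n : ℝ)⁻¹ : ℝ) : ℂ) * ψ (w - Real.log n)) (φ w))
    {h : ℝ → ℝ} {M : ℝ} (hmeas : Measurable h) (hM : ∀ u, |h u| ≤ M) (h0 : ∀ u < 0, h u = 0)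
    (u : ℝ) :
    ∫ v : ℝ, φ (u - v) * h v =
      ∫ v : ℝ, ψ (u - v) * ((∑' n : ℕ, (n : ℝ)⁻¹ * h (v - Real.log n) : ℝ) : ℂ) := by
  obtain ⟨hint, hsum⟩ := summable_integral_norm_mul_sub_log ψ hmeas hM h0 u
  have hshift (n : ℕ) (v : ℝ) : ((n : ℝ)⁻¹ : ℂ) * ψ (u - v) * h (v - Real.log n) =
      (fun v : ℝ => ((n : ℝ)⁻¹ : ℂ) * ψ (u - v - Real.log n) * h v) (v - Real.log n) := by
    ring_nf
  have hint' (n : ℕ) : Integrable fun v : ℝ =>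
      ((n : ℝ)⁻¹ : ℂ) * ψ (u - v) * h (v - Real.log n) := by
    simp_rw [hshift]
    exact (hint n).comp_sub_right _
  have hsum' : Summable fun n : ℕ => ∫ v : ℝ,
      ‖((n : ℝ)⁻¹ : ℂ) * ψ (u - v) * h (v - Real.log n)‖ := by
    refine hsum.congr fun n => ?_
    simp_rw [hshift]
    exact (integral_sub_right_eq_self (fun v : ℝ =>
      ‖((n : ℝ)⁻¹ : ℂ) * ψ (u - v - Real.log n) * h v‖) _).symm
  calc ∫ v : ℝ, φ (u - v) * h v
      = ∫ v : ℝ, ∑' n : ℕ, ((n : ℝ)⁻¹ : ℂ) * ψ (u - v - Real.log n) * h v := by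
        refine integral_congr_ae (Eventually.of_forall fun v => ?_)
        have := (hφ (u - v)).mul_right (h v : ℂ)
        push_cast at this
        exact this.tsum_eq.symm
    _ = ∑' n : ℕ, ∫ v : ℝ, ((n : ℝ)⁻¹ : ℂ) * ψ (u - v - Real.log n) * h v :=
        (integral_tsum_of_summable_integral_norm hint hsum).symm
    _ = ∑' n : ℕ, ∫ v : ℝ, ((n : ℝ)⁻¹ : ℂ) * ψ (u - v) * h (v - Real.log n) := by
        refine tsum_congr fun n => ?_
        simp_rw [hshift]
        exact (integral_sub_right_eq_self (fun v : ℝ =>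
          ((n : ℝ)⁻¹ : ℂ) * ψ (u - v - Real.log n) * h v) _).symm
    _ = ∫ v : ℝ, ∑' n : ℕ, ((n : ℝ)⁻¹ : ℂ) * ψ (u - v) * h (v - Real.log n) :=
        integral_tsum_of_summable_integral_norm hint' hsum'
    _ = _ := by
        refine integral_congr_ae (Eventually.of_forall fun v => ?_)
        simp only
        rw [Complex.ofReal_tsum, ← tsum_mul_left]
        refine tsum_congr fun n => ?_
        push_cast
        ring

theorem tendsto_integral_sub_mul_zero {ψ : ℝ → ℂ} (hψ : Integrable ψ) {H : ℝ → ℝ} {D : ℝ}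
    (hmeas : Measurable H) (hD : ∀ v, |H v| ≤ D) (hlim : Tendsto H atTop (𝓝 0)) :
    Tendsto (fun u : ℝ => ∫ v : ℝ, ψ (u - v) * (H v : ℂ)) atTop (𝓝 0) := by
  have h1 (u : ℝ) : ∫ v : ℝ, ψ (u - v) * (H v : ℂ) = ∫ v : ℝ, ψ v * (H (u - v) : ℂ) := by
    rw [← integral_sub_left_eq_self (fun v => ψ v * (H (u - v) : ℂ)) volume u]
    simp
  simp_rw [h1]
  rw [← integral_zero ℝ ℂ (μ := volume)]
  apply tendsto_integral_filter_of_dominated_convergence (fun v => ‖ψ v‖ * D)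
  · refine Eventually.of_forall fun u => hψ.aestronglyMeasurable.mul ?_
    exact (Complex.measurable_ofReal.comp
      (hmeas.comp (measurable_const.sub measurable_id))).aestronglyMeasurable
  · refine Eventually.of_forall fun u => Eventually.of_forall fun v => ?_
    rw [norm_mul, Complex.norm_real]
    gcongr
    exact hD _
  · exact hψ.norm.mul_const D
  · refine Eventually.of_forall fun v => ?_
    have h2 : Tendsto (fun u : ℝ => H (u - v)) atTop (𝓝 0) :=
      hlim.comp (tendsto_atTop_add_const_right _ (-v) tendsto_id)
    have h3 := ((Complex.continuous_ofReal.tendsto _).comp h2).const_mul (ψ v)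
    simpa using h3

/-- A function with a lower Lipschitz bound whose averages against arbitrarily narrow rescalings of
a nonnegative kernel tend to zero tends to zero. -/
theorem tendsto_zero_of_tendsto_averages {φ h : ℝ → ℝ} {K M : ℝ} (hφ0 : ∀ y, 0 ≤ φ y)
    (hφ : Integrable φ) (hφ2 : Integrable fun y => φ y * y ^ 2) (hφpos : 0 < ∫ y, φ y)
    (hmeas : Measurable h) (hM : ∀ u, |h u| ≤ M) (hK : 0 ≤ K)
    (hslow : ∀ u v, 0 ≤ u → u ≤ v → h u - K * (v - u) ≤ h v)
    (hlim : ∀ c : ℝ, 0 < c → Tendsto (fun u => ∫ y, φ y * h (u - y / c)) atTop (𝓝 0)) :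
    Tendsto h atTop (𝓝 0) := by
  have hM0 : 0 ≤ M := (abs_nonneg _).trans (hM 0)
  set I := ∫ y, φ y with hI
  set V := ∫ y, φ y * y ^ 2 with hV
  have hV0 : 0 ≤ V := integral_nonneg fun y => mul_nonneg (hφ0 y) (sq_nonneg y)
  rw [Metric.tendsto_atTop]
  intro ε hε
  set δ := ε / (8 * (K + 1)) with hδ
  have hδ0 : 0 < δ := by positivity
  have hKδ : 2 * K * δ ≤ ε / 4 := by
    have : δ * (8 * (K + 1)) = ε := by rw [hδ]; field_simp
    nlinarith
  set s := 8 * M * V / (I * ε) + 1 with hs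
  have hs1 : 1 ≤ s := by
    have : 0 ≤ 8 * M * V / (I * ε) := by positivity
    linarith
  have hsV : 2 * M * (V / s ^ 2) ≤ I * (ε / 4) := by
    have h1 : (s - 1) * (I * ε) = 8 * M * V := by rw [hs]; field_simp; ring
    rw [← mul_div_assoc, div_le_iff₀ (by positivity)]
    have h2 : s - 1 ≤ s ^ 2 := by nlinarith
    nlinarith [mul_le_mul_of_nonneg_right h2 (by positivity : 0 ≤ I * ε)]
  have hc : 0 < s / δ := by positivity
  obtain ⟨U, hU⟩ := Metric.tendsto_atTop.mp (hlim (s / δ) hc) (I * (ε / 4)) (by positivity)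
  have hfar (y : ℝ) (hy : δ < |y / (s / δ)|) : 1 ≤ y ^ 2 / s ^ 2 := by
    have h1 : |y / (s / δ)| = |y / s| * δ := by
      rw [div_div_eq_mul_div, mul_div_right_comm, abs_mul, abs_of_pos hδ0]
    have h2 : 1 < |y / s| := by
      rw [h1] at hy
      nlinarith
    rw [← div_pow, ← sq_abs]
    nlinarith
  have hint (u : ℝ) : Integrable fun y => φ y * h (u - y / (s / δ)) := by
    refine hφ.mul_bdd (c := M) ?_ (Eventually.of_forall fun y => by simpa using hM _)
    exact (hmeas.comp (by fun_prop)).aestronglyMeasurable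
  have hcalc (a : ℝ) (b : ℝ) : ∫ y, (φ y * a + b * (φ y * y ^ 2)) = I * a + b * V := by
    rw [integral_add (hφ.mul_const a) (hφ2.const_mul b), integral_mul_const, integral_const_mul]
  refine ⟨max U 0 + 2 * δ, fun w hw => ?_⟩
  have hwU : U + 2 * δ ≤ w := by linarith [le_max_left U 0]
  have hw0 : 2 * δ ≤ w := by linarith [le_max_right U 0]
  rw [Real.dist_0_eq_abs, abs_lt]
  constructor
  · have hpt (y : ℝ) : φ y * h (w - δ - y / (s / δ)) ≤
        φ y * (h w + 2 * K * δ) + 2 * M / s ^ 2 * (φ y * y ^ 2) := by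
      have : h (w - δ - y / (s / δ)) ≤ h w + 2 * K * δ + 2 * M * (y ^ 2 / s ^ 2) := by
        rcases le_or_gt |y / (s / δ)| δ with hy | hy
        · have hy' := abs_le.mp hy
          have h1 := hslow (w - δ - y / (s / δ)) w (by linarith) (by linarith)
          have h2 : 0 ≤ 2 * M * (y ^ 2 / s ^ 2) := by positivity
          nlinarith
        · have h1 := abs_le.mp (hM (w - δ - y / (s / δ)))
          have h2 := abs_le.mp (hM w)
          have h3 := mul_le_mul_of_nonneg_left (hfar y hy) (by positivity : 0 ≤ 2 * M)
          have h4 : 0 ≤ 2 * K * δ := by positivity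
          linarith
      calc _ ≤ φ y * (h w + 2 * K * δ + 2 * M * (y ^ 2 / s ^ 2)) :=
            mul_le_mul_of_nonneg_left this (hφ0 y)
        _ = _ := by ring
    have h1 := integral_mono (hint (w - δ))
      ((hφ.mul_const (h w + 2 * K * δ)).add (hφ2.const_mul (2 * M / s ^ 2))) hpt
    simp only [Pi.add_apply] at h1
    rw [hcalc] at h1
    have h2 := hU (w - δ) (by linarith)
    rw [Real.dist_0_eq_abs, abs_lt] at h2
    have h3 : 2 * M / s ^ 2 * V = 2 * M * (V / s ^ 2) := by ring
    have h4 : 0 < I * (h w + 2 * K * δ + ε / 2) := by nlinarith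
    have := pos_of_mul_pos_right h4 hφpos.le
    linarith
  · have hpt (y : ℝ) : φ y * (h w - 2 * K * δ) + -(2 * M / s ^ 2) * (φ y * y ^ 2) ≤
        φ y * h (w + δ - y / (s / δ)) := by
      have : h w - 2 * K * δ - 2 * M * (y ^ 2 / s ^ 2) ≤ h (w + δ - y / (s / δ)) := by
        rcases le_or_gt |y / (s / δ)| δ with hy | hy
        · have hy' := abs_le.mp hy
          have h1 := hslow w (w + δ - y / (s / δ)) (by linarith) (by linarith)
          have h2 : 0 ≤ 2 * M * (y ^ 2 / s ^ 2) := by positivity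
          nlinarith
        · have h1 := abs_le.mp (hM (w + δ - y / (s / δ)))
          have h2 := abs_le.mp (hM w)
          have h3 := mul_le_mul_of_nonneg_left (hfar y hy) (by positivity : 0 ≤ 2 * M)
          have h4 : 0 ≤ 2 * K * δ := by positivity
          linarith
      calc _ = φ y * (h w - 2 * K * δ - 2 * M * (y ^ 2 / s ^ 2)) := by ring
        _ ≤ _ := mul_le_mul_of_nonneg_left this (hφ0 y)
    have h1 := integral_mono
      ((hφ.mul_const (h w - 2 * K * δ)).add (hφ2.const_mul (-(2 * M / s ^ 2)))) (hint (w + δ)) hpt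
    simp only [Pi.add_apply] at h1
    rw [hcalc] at h1
    have h2 := hU (w + δ) (by linarith)
    rw [Real.dist_0_eq_abs, abs_lt] at h2
    have h3 : -(2 * M / s ^ 2) * V = -(2 * M * (V / s ^ 2)) := by ring
    have h4 : 0 < I * (ε / 2 - (h w - 2 * K * δ)) := by nlinarith
    have := pos_of_mul_pos_right h4 hφpos.le
    linarith

/-- A nonnegative Fejér type kernel. -/
theorem exists_compactSupport_fourier_nonneg :
    ∃ (m : 𝓢(ℝ, ℂ)) (φ : ℝ → ℝ), HasCompactSupport m ∧ (∀ w, (𝓕 m : 𝓢(ℝ, ℂ)) w = (φ w : ℂ)) ∧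
      (∀ w, 0 ≤ φ w) ∧
      Integrable φ ∧ Integrable (fun y => φ y * y ^ 2) ∧ 0 < ∫ y, φ y := by
  let b : ContDiffBump (0 : ℝ) := ⟨1, 2, one_pos, one_lt_two⟩
  let β : ℝ → ℂ := fun v => (b v : ℂ)
  have hβs : HasCompactSupport β := b.hasCompactSupport.comp_left Complex.ofReal_zero
  have hβd : ContDiff ℝ ∞ β := Complex.ofRealCLM.contDiff.comp b.contDiff
  have hβi : Integrable β := hβd.continuous.integrable_of_hasCompactSupport hβs
  have hreal (w : ℝ) : ((𝓕 β w).re : ℂ) = 𝓕 β w := by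
    rw [← Complex.conj_eq_iff_re, Real.fourier_real_eq, ← integral_conj,
      ← integral_neg_eq_self]
    refine integral_congr_ae (Eventually.of_forall fun v => ?_)
    simp only [Circle.smul_def, smul_eq_mul, map_mul, β, Complex.conj_ofReal, b.neg]
    rw [← Circle.coe_inv_eq_conj, ← AddChar.map_neg_eq_inv]
    ring_nf
  let m : 𝓢(ℝ, ℂ) := (hβs.convolution (L := ContinuousLinearMap.mul ℂ ℂ) (μ := volume)
    hβs).toSchwartzMap
    (hβs.contDiff_convolution_right (ContinuousLinearMap.mul ℝ ℂ) hβi.locallyIntegrable hβd)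
  have hm : HasCompactSupport m :=
    hβs.convolution (L := ContinuousLinearMap.mul ℂ ℂ) (μ := volume) hβs
  have hmF (w : ℝ) : (𝓕 m) w = (((𝓕 β w).re ^ 2 : ℝ) : ℂ) := by
    push_cast
    rw [hreal, sq]
    exact Real.fourier_mul_convolution_eq hβi hβi w
  have hφ : (fun w => (𝓕 β w).re ^ 2) = fun w => ((𝓕 m) w).re := by
    ext w
    rw [hmF, Complex.ofReal_re]
  have hint : Integrable fun w => (𝓕 β w).re ^ 2 := by
    rw [hφ]
    exact (𝓕 m).integrable.re
  refine ⟨m, fun w => (𝓕 β w).re ^ 2, hm, hmF, fun w => sq_nonneg _, hint, ?_, ?_⟩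
  · refine ((𝓕 m).integrable_pow_mul volume 2).mono' ?_ (Eventually.of_forall fun y => ?_)
    · exact hint.aestronglyMeasurable.mul (by fun_prop)
    · rw [hmF, Complex.norm_real, norm_mul, mul_comm, norm_pow]
  · have hcont : Continuous fun w => (𝓕 β w).re ^ 2 := by
      rw [hφ]
      exact Complex.continuous_re.comp (𝓕 m).continuous
    rw [integral_pos_iff_support_of_nonneg (fun w => sq_nonneg _) hint]
    refine (hcont.isOpen_support).measure_pos volume ⟨0, ?_⟩
    have h0 : 𝓕 β 0 = ((∫ v, b v : ℝ) : ℂ) := by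
      rw [Real.fourier_real_eq, ← integral_complex_ofReal]
      simp [β]
    simp only [Function.mem_support, h0, Complex.ofReal_re]
    exact pow_ne_zero _ b.integral_pos.ne'

theorem exists_schwartz_fourier_eq_dilation (m : 𝓢(ℝ, ℂ)) (hm : HasCompactSupport m) {c : ℝ}
    (hc : 0 < c) :
    ∃ m' : 𝓢(ℝ, ℂ), HasCompactSupport m' ∧
      ∀ w : ℝ, (𝓕 m' : 𝓢(ℝ, ℂ)) w = c * (𝓕 m : 𝓢(ℝ, ℂ)) (c * w) := by
  have hcs : HasCompactSupport fun v : ℝ => m (c⁻¹ * v) :=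
    hm.comp_homeomorph (Homeomorph.mulLeft₀ c⁻¹ (inv_ne_zero hc.ne'))
  have hd : ContDiff ℝ ∞ fun v : ℝ => m (c⁻¹ * v) :=
    (m.smooth ⊤).comp (contDiff_const.mul contDiff_id)
  refine ⟨hcs.toSchwartzMap hd, hcs, fun w => ?_⟩
  rw [SchwartzMap.fourier_coe, SchwartzMap.fourier_coe, Real.fourier_real_eq,
    Real.fourier_real_eq]
  have h := Measure.integral_comp_mul_left (fun v : ℝ => 𝐞 (-(v * (c * w))) • m v) c⁻¹
  rw [inv_inv, abs_of_pos hc, Complex.real_smul] at h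
  rw [← h]
  refine integral_congr_ae (Eventually.of_forall fun v => ?_)
  have : c⁻¹ * v * (c * w) = v * w := by field_simp
  simp only [this]
  rfl

theorem tsum_inv_mul_sub_log_eq_sum {h : ℝ → ℝ} (h0 : ∀ u < 0, h u = 0) {N : ℕ} {v : ℝ}
    (hv : v < Real.log (N + 1)) :
    ∑' n : ℕ, (n : ℝ)⁻¹ * h (v - Real.log n) = ∑ n ∈ Icc 1 N, (n : ℝ)⁻¹ * h (v - Real.log n) := by
  refine tsum_eq_sum fun n hn => ?_
  rcases Nat.eq_zero_or_pos n with rfl | hn0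
  · simp
  · have hn1 : N + 1 ≤ n := by
      by_contra! h
      exact hn (mem_Icc.mpr ⟨hn0, by omega⟩)
    have : Real.log (N + 1) ≤ Real.log n :=
      Real.log_le_log (by positivity) (by exact_mod_cast hn1)
    rw [h0 _ (by linarith), mul_zero]

theorem exists_natCast_lt_log_add_one (U : ℝ) : ∃ N : ℕ, U < Real.log (N + 1) := by
  obtain ⟨N, hN⟩ := exists_nat_gt (Real.exp U)
  exact ⟨N, by rw [Real.lt_log_iff_exp_lt (by positivity)]; linarith⟩

theorem measurable_tsum_inv_mul_sub_log {h : ℝ → ℝ} (hmeas : Measurable h)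
    (h0 : ∀ u < 0, h u = 0) :
    Measurable fun v : ℝ => ∑' n : ℕ, (n : ℝ)⁻¹ * h (v - Real.log n) := by
  refine measurable_of_tendsto_metrizable
    (f := fun N : ℕ => fun v : ℝ => ∑ n ∈ Icc 1 N, (n : ℝ)⁻¹ * h (v - Real.log n)) ?_ ?_
  · exact fun N => Finset.measurable_fun_sum _ fun n _ =>
      (hmeas.comp (measurable_id.sub_const _)).const_mul _
  · rw [tendsto_pi_nhds]
    intro v
    obtain ⟨N, hN⟩ := exists_natCast_lt_log_add_one v
    refine tendsto_const_nhds.congr' ?_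
    filter_upwards [eventually_ge_atTop N] with N' hN'
    refine tsum_inv_mul_sub_log_eq_sum h0 (hN.trans_le (Real.log_le_log (by positivity) ?_))
    exact_mod_cast Nat.add_le_add_right hN' 1

theorem exists_abs_tsum_inv_mul_sub_log_le {h : ℝ → ℝ} {M : ℝ} (hM : ∀ u, |h u| ≤ M)
    (h0 : ∀ u < 0, h u = 0)
    (hH : Tendsto (fun u => ∑' n : ℕ, (n : ℝ)⁻¹ * h (u - Real.log n)) atTop (𝓝 0)) :
    ∃ D, ∀ v, |∑' n : ℕ, (n : ℝ)⁻¹ * h (v - Real.log n)| ≤ D := by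
  obtain ⟨U, hU⟩ := Metric.tendsto_atTop.mp hH 1 one_pos
  obtain ⟨N, hN⟩ := exists_natCast_lt_log_add_one U
  refine ⟨max 1 (∑ n ∈ Icc 1 N, (n : ℝ)⁻¹ * M), fun v => ?_⟩
  rcases le_or_gt U v with hv | hv
  · have := hU v hv
    rw [Real.dist_0_eq_abs] at this
    exact this.le.trans (le_max_left _ _)
  · refine le_trans ?_ (le_max_right _ _)
    rw [tsum_inv_mul_sub_log_eq_sum h0 (hv.trans hN)]
    refine (abs_sum_le_sum_abs _ _).trans (sum_le_sum fun n _ => ?_)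
    rw [abs_mul, abs_of_nonneg (by positivity : (0 : ℝ) ≤ (n : ℝ)⁻¹)]
    gcongr
    exact hM _

/-- A Wiener type Tauberian theorem for the measure with mass `1 / n` at `log n`. -/
theorem tendsto_zero_of_tendsto_tsum_inv_mul_sub_log {h : ℝ → ℝ} {K M : ℝ}
    (hmeas : Measurable h) (hM : ∀ u, |h u| ≤ M) (h0 : ∀ u < 0, h u = 0) (hK : 0 ≤ K)
    (hslow : ∀ u v, 0 ≤ u → u ≤ v → h u - K * (v - u) ≤ h v)
    (hH : Tendsto (fun u => ∑' n : ℕ, (n : ℝ)⁻¹ * h (u - Real.log n)) atTop (𝓝 0)) :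
    Tendsto h atTop (𝓝 0) := by
  obtain ⟨m, φ, hm, hmφ, hφ0, hφ, hφ2, hφpos⟩ := exists_compactSupport_fourier_nonneg
  refine tendsto_zero_of_tendsto_averages hφ0 hφ hφ2 hφpos hmeas hM hK hslow fun c hc => ?_
  obtain ⟨m', hm', hmm'⟩ := exists_schwartz_fourier_eq_dilation m hm hc
  obtain ⟨p, hp⟩ := exists_schwartz_div_riemannZeta m' hm'
  obtain ⟨D, hD⟩ := exists_abs_tsum_inv_mul_sub_log_le hM h0 hH
  have hlim := tendsto_integral_sub_mul_zero (𝓕 p).integrable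
    (measurable_tsum_inv_mul_sub_log hmeas h0) hD hH
  simp_rw [← integral_mul_eq_integral_mul_tsum _ (𝓕 p)
    (hasSum_fourier_of_eq_mul_div_riemannZeta m' p hm' hp) hmeas hM h0] at hlim
  have heq (u : ℝ) : ∫ v : ℝ, (𝓕 m' : 𝓢(ℝ, ℂ)) (u - v) * (h v : ℂ) =
      ((∫ y, φ y * h (u - y / c) : ℝ) : ℂ) := by
    rw [← integral_sub_left_eq_self (fun v => (𝓕 m' : 𝓢(ℝ, ℂ)) (u - v) * (h v : ℂ)) volume u,
      ← integral_complex_ofReal]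
    have h1 := Measure.integral_comp_mul_left
      (fun y : ℝ => ((φ y * h (u - y / c) : ℝ) : ℂ)) c
    rw [abs_of_pos (inv_pos.mpr hc), Complex.real_smul, Complex.ofReal_inv,
      eq_inv_mul_iff_mul_eq₀ (by exact_mod_cast hc.ne')] at h1
    rw [← h1, ← integral_const_mul]
    refine integral_congr_ae (Eventually.of_forall fun v => ?_)
    simp only [sub_sub_cancel, hmm', hmφ, mul_div_cancel_left₀ v hc.ne']
    push_cast
    ring
  simp_rw [heq] at hlim
  exact_mod_cast (Complex.continuous_re.tendsto 0).comp hlim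

theorem sub_half_le_sum_sub_two_mul_sum {f : ℝ → ℝ} (hf : Monotone f) {x : ℝ} (hx : 0 ≤ x)
    (N : ℕ) :
    f x - f (x / 2) ≤ ∑ n ∈ Icc 1 (2 * (N + 1)), f (x / n) -
      2 * ∑ n ∈ Icc 1 (N + 1), f (x / 2 / n) := by
  induction N with
  | zero =>
    have h2 : Icc 1 (2 * (0 + 1)) = {1, 2} := by decide
    rw [h2, Finset.sum_pair (by norm_num)]
    norm_num
    linarith
  | succ N ih =>
    rw [show 2 * (N + 1 + 1) = 2 * (N + 1) + 1 + 1 by ring, Finset.sum_Icc_succ_top (by omega),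
      Finset.sum_Icc_succ_top (by omega), Finset.sum_Icc_succ_top (b := N + 1) (by omega)]
    have h1 : x / 2 / ((N + 1 + 1 : ℕ) : ℝ) = x / ((2 * (N + 1) + 1 + 1 : ℕ) : ℝ) := by
      rw [div_div]
      push_cast
      ring_nf
    have h2 : x / ((2 * (N + 1) + 1 + 1 : ℕ) : ℝ) ≤ x / ((2 * (N + 1) + 1 : ℕ) : ℝ) := by
      gcongr
      omega
    have h3 := hf h2
    rw [h1]
    linarith

theorem sum_floor_eq_sum_of_floor_le {f : ℝ → ℝ} (hf0 : ∀ x < 1, f x = 0) {x : ℝ} {N : ℕ}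
    (hN : ⌊x⌋₊ ≤ N) : ∑ n ∈ Icc 1 ⌊x⌋₊, f (x / n) = ∑ n ∈ Icc 1 N, f (x / n) := by
  refine Finset.sum_subset (Finset.Icc_subset_Icc_right hN) fun n hn hn' => hf0 _ ?_
  have h1 : 1 ≤ n := (mem_Icc.mp hn).1
  have h2 : ⌊x⌋₊ < n := by
    by_contra! h
    exact hn' (mem_Icc.mpr ⟨h1, h⟩)
  rw [div_lt_one (by exact_mod_cast h1)]
  exact (Nat.floor_lt' (by omega)).mp h2

theorem sub_half_le_sum_floor_sub {f : ℝ → ℝ} (hf : Monotone f) (hf0 : ∀ x < 1, f x = 0) {x : ℝ}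
    (hx : 1 ≤ x) :
    f x - f (x / 2) ≤ ∑ n ∈ Icc 1 ⌊x⌋₊, f (x / n) - 2 * ∑ n ∈ Icc 1 ⌊x / 2⌋₊, f (x / 2 / n) := by
  obtain ⟨N, hN⟩ : ∃ N, ⌊x⌋₊ = N + 1 :=
    ⟨⌊x⌋₊ - 1, by have := Nat.le_floor (n := 1) (by simpa using hx); omega⟩
  rw [sum_floor_eq_sum_of_floor_le hf0 (N := 2 * (N + 1)) (by omega),
    sum_floor_eq_sum_of_floor_le hf0 (x := x / 2) (N := N + 1)
      (by rw [← hN]; exact Nat.floor_le_floor (by linarith))]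
  exact sub_half_le_sum_sub_two_mul_sum hf (by linarith) N

theorem exists_le_mul_of_sub_half_le {f : ℝ → ℝ} (hf : Monotone f) (hnn : ∀ x, 0 ≤ f x) {K X : ℝ}
    (hK : 0 ≤ K) (hX : 1 ≤ X) (h : ∀ x, X ≤ x → f x - f (x / 2) ≤ K * x) :
    ∃ D, 0 ≤ D ∧ ∀ x, 1 ≤ x → f x ≤ D * x := by
  have key (k : ℕ) : ∀ x, 0 ≤ x → x ≤ 2 ^ k * X → f x ≤ f X + 2 * K * x := by
    induction k with
    | zero =>
      intro x hx0 hx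
      have := hf (show x ≤ X by simpa using hx)
      nlinarith
    | succ k ih =>
      intro x hx0 hx
      rcases le_total x X with hxX | hxX
      · have := hf hxX
        nlinarith
      · have h1 := ih (x / 2) (by linarith) (by rw [pow_succ] at hx; linarith)
        have h2 := h x hxX
        linarith
  refine ⟨f X + 2 * K, by have := hnn X; positivity, fun x hx => ?_⟩
  obtain ⟨k, hk⟩ := pow_unbounded_of_one_lt x one_lt_two
  have h1 := key k x (by linarith) (by nlinarith)
  nlinarith [hnn X]

theorem exists_le_mul_of_tendsto_sum_floor {f : ℝ → ℝ} (hf : Monotone f) (hnn : ∀ x, 0 ≤ f x)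
    (hf0 : ∀ x < 1, f x = 0) {A B : ℝ}
    (hF : Tendsto (fun x : ℝ => (∑ n ∈ Icc 1 ⌊x⌋₊, f (x / n)) / x - A * Real.log x - B)
      atTop (𝓝 0)) :
    ∃ D, 0 ≤ D ∧ ∀ x, 1 ≤ x → f x ≤ D * x := by
  obtain ⟨X, hX⟩ := Metric.tendsto_atTop.mp hF 1 one_pos
  have hX' (x : ℝ) (hx : max X 1 ≤ x) :
      |∑ n ∈ Icc 1 ⌊x⌋₊, f (x / n) - A * x * Real.log x - B * x| ≤ x := by
    have hx1 : 0 < x := by linarith [le_max_right X 1]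
    have := hX x ((le_max_left _ _).trans hx)
    rw [Real.dist_0_eq_abs] at this
    have h2 : ∑ n ∈ Icc 1 ⌊x⌋₊, f (x / n) - A * x * Real.log x - B * x =
        ((∑ n ∈ Icc 1 ⌊x⌋₊, f (x / n)) / x - A * Real.log x - B) * x := by
      field_simp
    rw [h2, abs_mul, abs_of_pos hx1]
    nlinarith
  refine exists_le_mul_of_sub_half_le hf hnn (K := |A| + 2) (X := 2 * max X 1) (by positivity)
    (by linarith [le_max_right X 1]) fun x hx => ?_
  have hx1 : 1 ≤ x := by linarith [le_max_right X 1]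
  have h1 := (abs_le.mp (hX' x (by linarith [le_max_right X 1]))).2
  have h2 := (abs_le.mp (hX' (x / 2) (by linarith))).1
  have h3 := sub_half_le_sum_floor_sub hf hf0 hx1
  rw [Real.log_div (by linarith) two_ne_zero] at h2
  have h4 : A * x * Real.log 2 ≤ |A| * x := by
    have h5 : A * Real.log 2 ≤ |A| := by
      have : |A * Real.log 2| ≤ |A| * 1 := by
        rw [abs_mul, abs_of_pos (Real.log_pos one_lt_two)]
        gcongr
        linarith [Real.log_two_lt_d9]
      linarith [le_abs_self (A * Real.log 2)]
    nlinarith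
  linarith

theorem tendsto_sum_floor_inv_sub_log :
    Tendsto (fun x : ℝ => ∑ n ∈ Icc 1 ⌊x⌋₊, (n : ℝ)⁻¹ - Real.log x) atTop
      (𝓝 eulerMascheroniConstant) := by
  have h1 := tendsto_harmonic_sub_log.comp (tendsto_nat_floor_atTop (α := ℝ))
  have h2 : Tendsto (fun x : ℝ => Real.log ((⌊x⌋₊ : ℝ) / x)) atTop (𝓝 0) := by
    have := (Real.continuousAt_log one_ne_zero).tendsto.comp (tendsto_nat_floor_div_atTop (R := ℝ))
    rwa [Real.log_one] at this
  have h3 := h1.add h2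
  rw [add_zero] at h3
  refine h3.congr' ?_
  filter_upwards [eventually_ge_atTop 1] with x hx
  have hx0 : (⌊x⌋₊ : ℝ) ≠ 0 := by
    have := Nat.le_floor (n := 1) (by simpa using hx)
    exact_mod_cast (by omega)
  simp only [Function.comp_apply]
  rw [Real.log_div hx0 (by linarith), harmonic_eq_sum_Icc]
  push_cast
  ring

/-- The Landau–Ingham theorem with the weaker error term `o(x)`. -/
theorem tendsto_div_of_tendsto_sum_floor {f : ℝ → ℝ} (hf : Monotone f) (hnn : ∀ x, 0 ≤ f x)
    (hf0 : ∀ x < 1, f x = 0) {A B : ℝ}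
    (hF : Tendsto (fun x : ℝ => (∑ n ∈ Icc 1 ⌊x⌋₊, f (x / n)) / x - A * Real.log x - B)
      atTop (𝓝 0)) :
    Tendsto (fun x : ℝ => f x / x) atTop (𝓝 A) := by
  obtain ⟨D, hD0, hD⟩ := exists_le_mul_of_tendsto_sum_floor hf hnn hf0 hF
  set b := B - A * eulerMascheroniConstant with hb
  set h : ℝ → ℝ := fun u =>
    if 0 ≤ u then f (Real.exp u) * Real.exp (-u) - A - b * Real.exp (-u) else 0 with hh
  have hpos (u : ℝ) (hu : 0 ≤ u) :
      h u = f (Real.exp u) * Real.exp (-u) - A - b * Real.exp (-u) := if_pos hu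
  have h0 (u : ℝ) (hu : u < 0) : h u = 0 := if_neg hu.not_ge
  have hfD (u : ℝ) (hu : 0 ≤ u) : f (Real.exp u) * Real.exp (-u) ≤ D := by
    have := hD _ (Real.one_le_exp hu)
    rwa [Real.exp_neg, ← div_eq_mul_inv, div_le_iff₀ (Real.exp_pos u)]
  have hmeas : Measurable h := by
    have := hf.measurable
    exact Measurable.ite measurableSet_Ici (by fun_prop) measurable_const
  have hM (u : ℝ) : |h u| ≤ D + |A| + |b| := by
    rcases lt_or_ge u 0 with hu | hu
    · rw [h0 u hu, abs_zero]
      positivity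
    · rw [hpos u hu]
      have h1 : |f (Real.exp u) * Real.exp (-u)| ≤ D := by
        rw [abs_of_nonneg (mul_nonneg (hnn _) (Real.exp_pos _).le)]
        exact hfD u hu
      have h2 : |b * Real.exp (-u)| ≤ |b| := by
        rw [abs_mul, abs_of_pos (Real.exp_pos _)]
        exact mul_le_of_le_one_right (abs_nonneg _) (Real.exp_le_one_iff.mpr (by linarith))
      exact (abs_sub _ _).trans (add_le_add ((abs_sub _ _).trans (by gcongr)) h2)
  have hslow (u v : ℝ) (hu : 0 ≤ u) (huv : u ≤ v) : h u - (D + |b|) * (v - u) ≤ h v := by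
    rw [hpos u hu, hpos v (hu.trans huv)]
    have h1 : Real.exp (-v) = Real.exp (-u) * Real.exp (-(v - u)) := by
      rw [← Real.exp_add]
      ring_nf
    have h2 : 1 - Real.exp (-(v - u)) ≤ v - u := by linarith [Real.add_one_le_exp (-(v - u))]
    have h2' : 0 ≤ 1 - Real.exp (-(v - u)) := by
      linarith [Real.exp_le_one_iff.mpr (show -(v - u) ≤ 0 by linarith)]
    have h3 : f (Real.exp u) * Real.exp (-v) ≤ f (Real.exp v) * Real.exp (-v) :=
      mul_le_mul_of_nonneg_right (hf (Real.exp_le_exp.mpr huv)) (Real.exp_pos _).le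
    have h4 : f (Real.exp u) * Real.exp (-u) * (1 - Real.exp (-(v - u))) ≤ D * (v - u) :=
      mul_le_mul (hfD u hu) h2 h2' hD0
    have h5 : -(b * Real.exp (-u)) * (1 - Real.exp (-(v - u))) ≤ |b| * (v - u) := by
      refine mul_le_mul ?_ h2 h2' (abs_nonneg _)
      rw [← neg_mul]
      calc -b * Real.exp (-u) ≤ |b| * Real.exp (-u) := by gcongr; exact neg_le_abs b
        _ ≤ |b| := mul_le_of_le_one_right (abs_nonneg _) (Real.exp_le_one_iff.mpr (by linarith))
    rw [h1] at h3 ⊢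
    linarith
  have hsum (x : ℝ) (hx : 1 ≤ x) :
      ∑' n : ℕ, (n : ℝ)⁻¹ * h (Real.log x - Real.log n) =
        (∑ n ∈ Icc 1 ⌊x⌋₊, f (x / n)) / x - A * ∑ n ∈ Icc 1 ⌊x⌋₊, (n : ℝ)⁻¹ -
          b * ((⌊x⌋₊ : ℝ) / x) := by
    have hx0 : 0 < x := by linarith
    rw [tsum_inv_mul_sub_log_eq_sum h0 (Real.log_lt_log hx0 (Nat.lt_floor_add_one x)),
      Finset.sum_div, Finset.mul_sum, ← Finset.sum_sub_distrib]
    have hconst : b * ((⌊x⌋₊ : ℝ) / x) = ∑ n ∈ Icc 1 ⌊x⌋₊, b / x := by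
      rw [Finset.sum_const, Nat.card_Icc, nsmul_eq_mul, Nat.add_sub_cancel]
      ring
    rw [hconst, ← Finset.sum_sub_distrib]
    refine Finset.sum_congr rfl fun n hn => ?_
    obtain ⟨hn1, hn2⟩ := mem_Icc.mp hn
    have hn0 : (0 : ℝ) < n := by exact_mod_cast hn1
    have hnx : (n : ℝ) ≤ x := (Nat.le_floor_iff hx0.le).mp hn2
    rw [hpos _ (sub_nonneg.mpr (Real.log_le_log hn0 hnx)),
      ← Real.log_div hx0.ne' hn0.ne', Real.exp_neg, Real.exp_log (by positivity)]
    field_simp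
  have hlim : Tendsto (fun x : ℝ => ∑' n : ℕ, (n : ℝ)⁻¹ * h (Real.log x - Real.log n)) atTop
      (𝓝 0) := by
    have h1 := (hF.sub (((tendsto_sum_floor_inv_sub_log).sub_const
      eulerMascheroniConstant).const_mul A)).sub
      (((tendsto_nat_floor_div_atTop (R := ℝ)).sub_const 1).const_mul b)
    simp only [sub_self, mul_zero] at h1
    refine h1.congr' ?_
    filter_upwards [eventually_ge_atTop 1] with x hx
    rw [hsum x hx, hb]
    ring
  have hH : Tendsto (fun u : ℝ => ∑' n : ℕ, (n : ℝ)⁻¹ * h (u - Real.log n)) atTop (𝓝 0) := by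
    have := hlim.comp Real.tendsto_exp_atTop
    simpa [Function.comp_def] using this
  have hconc := (tendsto_zero_of_tendsto_tsum_inv_mul_sub_log hmeas hM h0 (by positivity) hslow
    hH).comp Real.tendsto_log_atTop
  have h2 := (hconc.add_const A).add ((tendsto_inv_atTop_zero (𝕜 := ℝ)).const_mul b)
  rw [mul_zero, add_zero, zero_add] at h2
  refine h2.congr' ?_
  filter_upwards [eventually_ge_atTop 1] with x hx
  have hx0 : 0 < x := by linarith
  simp only [Function.comp_apply]
  rw [hpos _ (Real.log_nonneg hx), Real.exp_neg, Real.exp_log hx0]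
  field_simp
  ring

theorem tendsto_div_sub_of_isLittleO {F : ℝ → ℝ} {A B C : ℝ}
    (hF : (fun x : ℝ => F x - (A * x * Real.log x + B * x + C * x / Real.log x))
      =o[atTop] fun x : ℝ => x / Real.log x) :
    Tendsto (fun x : ℝ => F x / x - A * Real.log x - B) atTop (𝓝 0) := by
  have h1 := (hF.tendsto_div_nhds_zero.add_const C).mul
    (tendsto_inv_atTop_zero.comp Real.tendsto_log_atTop)
  rw [mul_zero] at h1
  refine h1.congr' ?_
  filter_upwards [eventually_gt_atTop 1] with x hx
  have hl := Real.log_pos hx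
  have hx0 : 0 < x := by linarith
  simp only [Function.comp_apply]
  field_simp
  ring

/-- Landau–Ingham Tauberian theorem. -/
theorem landau_ingham
    (f : ℝ → ℝ) (A B C : ℝ)
    (hnonneg : ∀ x, 1 ≤ x → 0 ≤ f x)
    (hmono : ∀ x y, 1 ≤ x → x ≤ y → f x ≤ f y)
    (hF : (fun x : ℝ =>
        (∑ n ∈ Finset.Icc 1 ⌊x⌋₊, f (x / n)) -
          (A * x * Real.log x + B * x + C * x / Real.log x))
      =o[atTop] fun x : ℝ => x / Real.log x) :
    Tendsto (fun x : ℝ => f x / x) atTop (nhds A) := by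
  set g : ℝ → ℝ := fun x => if 1 ≤ x then f x else 0 with hg
  have hg1 (x : ℝ) (hx : 1 ≤ x) : g x = f x := if_pos hx
  have hg0 (x : ℝ) (hx : x < 1) : g x = 0 := if_neg hx.not_ge
  have hnn (x : ℝ) : 0 ≤ g x := by
    rcases lt_or_ge x 1 with hx | hx
    · exact (hg0 x hx).ge
    · exact (hnonneg x hx).trans_eq (hg1 x hx).symm
  have hgm : Monotone g := fun x y hxy => by
    rcases lt_or_ge x 1 with hx | hx
    · exact (hg0 x hx).trans_le (hnn y)
    · rw [hg1 x hx, hg1 y (hx.trans hxy)]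
      exact hmono x y hx hxy
  have hsum (x : ℝ) : ∑ n ∈ Icc 1 ⌊x⌋₊, g (x / n) = ∑ n ∈ Icc 1 ⌊x⌋₊, f (x / n) := by
    refine Finset.sum_congr rfl fun n hn => hg1 _ ?_
    obtain ⟨hn1, hn2⟩ := mem_Icc.mp hn
    rw [one_le_div (by exact_mod_cast hn1)]
    exact (Nat.le_floor_iff' (by omega)).mp hn2
  have hlim := tendsto_div_sub_of_isLittleO hF
  simp_rw [← hsum] at hlim
  refine (tendsto_div_of_tendsto_sum_floor hgm hnn hg0 hlim).congr' ?_
  filter_upwards [eventually_ge_atTop 1] with x hx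
  rw [hg1 x hx]
end

section
/- Let f : [1,∞) → ℝ be non-negative and non-decreasing, let F(x) = Σ_{n ≤ x} f(x/n), and assume F(x) = A·x·log x + B·x + C·x/log x + o(x/log x) as x → ∞ for real constants A, B, C. Set g(x) = f(x) − A·x. Then for every ε > 0 there exists X such that for all x ≥ X: |g(x)|/x ≤ (1/log x)·∫_1^x |g(t)|/t² dt + ε. -/
open Filter Real Finset

section SelbergInequality

open ArithmeticFunction ArithmeticFunction.Moebius ArithmeticFunction.zeta

/-- The sum `∑_{n ≤ x} a(n) u(x/n)`, the action of an arithmetic function on functions on `[1, ∞)`. -/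
noncomputable def dirichletSum (a : ℕ → ℝ) (u : ℝ → ℝ) (x : ℝ) : ℝ :=
  ∑ n ∈ Finset.Icc 1 ⌊x⌋₊, a n * u (x / n)

lemma icc_one_eq_ioc_zero (N : ℕ) : Finset.Icc 1 N = Finset.Ioc 0 N := by
  ext; simp; omega

lemma one_le_div_of_mem_icc {x : ℝ} {n : ℕ} (hn : n ∈ Finset.Icc 1 ⌊x⌋₊) :
    (1 : ℝ) ≤ n ∧ (1 : ℝ) ≤ x / n ∧ x / n ≤ x := by
  rw [Finset.mem_Icc] at hn
  have h1 : (1 : ℝ) ≤ n := by exact_mod_cast hn.1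
  have h2 : (n : ℝ) ≤ x := (Nat.le_floor_iff' (by omega)).1 hn.2
  exact ⟨h1, (one_le_div (by linarith)).2 h2, div_le_self (by linarith) h1⟩

lemma dirichletSum_comp (a b : ArithmeticFunction ℝ) (u : ℝ → ℝ) (x : ℝ) :
    dirichletSum a (dirichletSum b u) x = dirichletSum (a * b : ArithmeticFunction ℝ) u x := by
  simp only [dirichletSum, icc_one_eq_ioc_zero, ArithmeticFunction.mul_apply]
  set N := ⌊x⌋₊
  have h1 : ∀ n ∈ Finset.Ioc 0 N,
      (∑ p ∈ n.divisorsAntidiagonal, a p.1 * b p.2) * u (x / n) =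
      ∑ p ∈ Finset.Ioc 0 N ×ˢ Finset.Ioc 0 N with p.1 * p.2 = n,
        a p.1 * b p.2 * u (x / (p.1 * p.2 : ℕ)) := by
    intro n hn
    simp only [Finset.mem_Ioc] at hn
    rw [Nat.divisorsAntidiagonal_eq_prod_filter_of_le hn.1.ne' hn.2, Finset.sum_mul]
    refine Finset.sum_congr rfl fun p hp ↦ ?_
    rw [(Finset.mem_filter.1 hp).2]
  rw [Finset.sum_congr rfl h1]
  simp_rw [Finset.sum_filter]
  rw [Finset.sum_comm, Finset.sum_product]
  refine Finset.sum_congr rfl fun n hn ↦ ?_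
  rw [Finset.mul_sum, Nat.floor_div_natCast]
  rw [Finset.mem_Ioc] at hn
  simp only [Finset.sum_ite_eq, Finset.mem_Ioc]
  rw [← Finset.sum_filter]
  refine Finset.sum_congr ?_ fun m hm ↦ ?_
  · ext m
    simp only [Finset.mem_filter, Finset.mem_Ioc]
    rw [Nat.le_div_iff_mul_le hn.1, mul_comm m n]
    constructor
    · rintro ⟨h, h'⟩
      exact ⟨⟨h, (Nat.le_mul_of_pos_left m hn.1).trans h'⟩, Nat.mul_pos hn.1 h, h'⟩
    · rintro ⟨h, -, h'⟩
      exact ⟨h.1, h'⟩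
  · rw [div_div]; push_cast; ring

lemma dirichletSum_one (u : ℝ → ℝ) {x : ℝ} (hx : 1 ≤ x) :
    dirichletSum (1 : ArithmeticFunction ℝ) u x = u x := by
  have h : 1 ∈ Finset.Icc 1 ⌊x⌋₊ := by simpa using Nat.one_le_floor_iff x |>.2 hx
  rw [dirichletSum, Finset.sum_eq_single_of_mem 1 h]
  · simp
  · intro n _ hn
    simp [hn]

lemma dirichletSum_congr {a : ℕ → ℝ} {u v : ℝ → ℝ} {x : ℝ} (h : ∀ y, 1 ≤ y → u y = v y) :
    dirichletSum a u x = dirichletSum a v x :=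
  Finset.sum_congr rfl fun n hn ↦ by rw [h _ (one_le_div_of_mem_icc hn).2.1]

lemma dirichletSum_add (a : ℕ → ℝ) (u v : ℝ → ℝ) (x : ℝ) :
    dirichletSum a (fun y ↦ u y + v y) x = dirichletSum a u x + dirichletSum a v x := by
  simp [dirichletSum, mul_add, Finset.sum_add_distrib]

lemma dirichletSum_const_mul (a : ℕ → ℝ) (c : ℝ) (u : ℝ → ℝ) (x : ℝ) :
    dirichletSum a (fun y ↦ c * u y) x = c * dirichletSum a u x := by
  simp only [dirichletSum, Finset.mul_sum]
  exact Finset.sum_congr rfl fun n _ ↦ by ring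

lemma dirichletSum_zeta (u : ℝ → ℝ) (x : ℝ) :
    dirichletSum (ζ : ArithmeticFunction ℝ) u x = ∑ n ∈ Finset.Icc 1 ⌊x⌋₊, u (x / n) := by
  refine Finset.sum_congr rfl fun n hn ↦ ?_
  have : n ≠ 0 := by rw [Finset.mem_Icc] at hn; omega
  simp [ArithmeticFunction.natCoe_apply, ArithmeticFunction.zeta_apply, this]

lemma abs_dirichletSum_le {a b : ℕ → ℝ} {u v : ℝ → ℝ} {x : ℝ} (ha : ∀ n, |a n| ≤ b n)
    (hu : ∀ y, 1 ≤ y → |u y| ≤ v y) : |dirichletSum a u x| ≤ dirichletSum b v x := by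
  refine (Finset.abs_sum_le_sum_abs _ _).trans (Finset.sum_le_sum fun n hn ↦ ?_)
  rw [abs_mul]
  exact mul_le_mul (ha n) (hu _ (one_le_div_of_mem_icc hn).2.1) (abs_nonneg _)
    ((abs_nonneg _).trans (ha n))

lemma moebius_dirichletSum_zeta (u : ℝ → ℝ) {x : ℝ} (hx : 1 ≤ x) :
    dirichletSum (μ : ArithmeticFunction ℝ) (dirichletSum (ζ : ArithmeticFunction ℝ) u) x = u x := by
  rw [dirichletSum_comp, coe_moebius_mul_coe_zeta, dirichletSum_one u hx]

/-- The Tatuzawa–Iseki identity. -/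
lemma moebius_dirichletSum_log_mul (u : ℝ → ℝ) {x : ℝ} (hx : 1 ≤ x) :
    dirichletSum (μ : ArithmeticFunction ℝ)
      (fun y ↦ Real.log y * dirichletSum (ζ : ArithmeticFunction ℝ) u y) x =
      Real.log x * u x + dirichletSum Λ u x := by
  have h : ∀ y : ℝ, 1 ≤ y → Real.log y * dirichletSum (ζ : ArithmeticFunction ℝ) u y =
      dirichletSum (ζ : ArithmeticFunction ℝ) (fun t ↦ Real.log t * u t) y +
      dirichletSum ArithmeticFunction.log u y := by
    intro y hy
    rw [dirichletSum_zeta, dirichletSum_zeta, dirichletSum, ← Finset.sum_add_distrib,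
      Finset.mul_sum]
    refine Finset.sum_congr rfl fun n hn ↦ ?_
    have := (one_le_div_of_mem_icc hn).1
    rw [ArithmeticFunction.log_apply, Real.log_div (by linarith) (by linarith)]
    ring
  rw [dirichletSum_congr h, dirichletSum_add, moebius_dirichletSum_zeta _ hx, dirichletSum_comp,
    moebius_mul_log_eq_vonMangoldt]

/-- `r = o(x)`, uniformly on `[1, ∞)`. -/
def IsSublinear (r : ℝ → ℝ) : Prop :=
  ∀ δ > (0 : ℝ), ∃ K, 0 ≤ K ∧ ∀ x, 1 ≤ x → |r x| ≤ δ * x + K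

/-- `r = o(x log x)`, uniformly on `[1, ∞)`. -/
def IsSublinearLog (r : ℝ → ℝ) : Prop :=
  ∀ δ > (0 : ℝ), ∃ K, 0 ≤ K ∧ ∀ x, 1 ≤ x → |r x| ≤ δ * (x * Real.log x) + K * x

lemma IsSublinearLog.congr {r s : ℝ → ℝ} (hr : IsSublinearLog r) (h : ∀ x, 1 ≤ x → s x = r x) :
    IsSublinearLog s := fun δ hδ ↦ by
  obtain ⟨K, hK0, hK⟩ := hr δ hδ
  exact ⟨K, hK0, fun x hx ↦ by rw [h x hx]; exact hK x hx⟩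

lemma IsSublinear.add {r s : ℝ → ℝ} (hr : IsSublinear r) (hs : IsSublinear s) :
    IsSublinear fun x ↦ r x + s x := fun δ hδ ↦ by
  obtain ⟨K, hK0, hK⟩ := hr (δ / 2) (by positivity)
  obtain ⟨L, hL0, hL⟩ := hs (δ / 2) (by positivity)
  refine ⟨K + L, by positivity, fun x hx ↦ (abs_add_le _ _).trans ?_⟩
  linarith [hK x hx, hL x hx]

lemma IsSublinearLog.add {r s : ℝ → ℝ} (hr : IsSublinearLog r) (hs : IsSublinearLog s) :
    IsSublinearLog fun x ↦ r x + s x := fun δ hδ ↦ by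
  obtain ⟨K, hK0, hK⟩ := hr (δ / 2) (by positivity)
  obtain ⟨L, hL0, hL⟩ := hs (δ / 2) (by positivity)
  refine ⟨K + L, by positivity, fun x hx ↦ (abs_add_le _ _).trans ?_⟩
  linarith [hK x hx, hL x hx]

lemma IsSublinear.const_mul {r : ℝ → ℝ} (hr : IsSublinear r) (c : ℝ) :
    IsSublinear fun x ↦ c * r x := fun δ hδ ↦ by
  obtain ⟨K, hK0, hK⟩ := hr (δ / (|c| + 1)) (by positivity)
  refine ⟨|c| * K, by positivity, fun x hx ↦ ?_⟩
  rw [abs_mul]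
  have h1 : |c| * (δ / (|c| + 1)) ≤ δ := by
    rw [← mul_div_assoc, div_le_iff₀ (by positivity)]
    nlinarith
  have h2 := mul_le_mul_of_nonneg_left (hK x hx) (abs_nonneg c)
  nlinarith

lemma IsSublinearLog.const_mul {r : ℝ → ℝ} (hr : IsSublinearLog r) (c : ℝ) :
    IsSublinearLog fun x ↦ c * r x := fun δ hδ ↦ by
  obtain ⟨K, hK0, hK⟩ := hr (δ / (|c| + 1)) (by positivity)
  refine ⟨|c| * K, by positivity, fun x hx ↦ ?_⟩
  rw [abs_mul]
  have h1 : |c| * (δ / (|c| + 1)) ≤ δ := by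
    rw [← mul_div_assoc, div_le_iff₀ (by positivity)]
    nlinarith
  have h2 := mul_le_mul_of_nonneg_left (hK x hx) (abs_nonneg c)
  have h3 : 0 ≤ x * Real.log x := mul_nonneg (by linarith) (Real.log_nonneg hx)
  nlinarith

lemma isSublinear_of_bounded {r : ℝ → ℝ} (K : ℝ) (h : ∀ x, 1 ≤ x → |r x| ≤ K) :
    IsSublinear r := fun δ hδ ↦ by
  refine ⟨K, (abs_nonneg _).trans (h 1 le_rfl), fun x hx ↦ ?_⟩
  nlinarith [h x hx]

lemma isSublinearLog_of_linear {r : ℝ → ℝ} (K : ℝ) (h : ∀ x, 1 ≤ x → |r x| ≤ K * x) :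
    IsSublinearLog r := fun δ hδ ↦ by
  refine ⟨K, by simpa using (abs_nonneg _).trans (h 1 le_rfl), fun x hx ↦ ?_⟩
  have h3 : 0 ≤ x * Real.log x := mul_nonneg (by linarith) (Real.log_nonneg hx)
  nlinarith [h x hx]

lemma isSublinear_of_isLittleO {r : ℝ → ℝ} (h : r =o[atTop] fun x : ℝ ↦ x)
    (hb : ∀ Y : ℝ, ∃ K, ∀ x, 1 ≤ x → x ≤ Y → |r x| ≤ K) : IsSublinear r := fun δ hδ ↦ by
  obtain ⟨Y, hY⟩ := eventually_atTop.1 (h.def hδ)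
  obtain ⟨K, hK⟩ := hb Y
  refine ⟨max K 0, le_max_right _ _, fun x hx ↦ ?_⟩
  have h0 : 0 ≤ δ * x := by positivity
  rcases le_total Y x with hxY | hxY
  · have := hY x hxY
    rw [Real.norm_eq_abs, Real.norm_eq_abs, abs_of_nonneg (by linarith : (0 : ℝ) ≤ x)] at this
    linarith [le_max_right K 0]
  · linarith [hK x hx hxY, le_max_left K 0]

lemma isSublinear_log : IsSublinear Real.log := fun δ hδ ↦ by
  refine ⟨|Real.log δ|, abs_nonneg _, fun x hx ↦ ?_⟩
  rw [abs_of_nonneg (Real.log_nonneg hx)]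
  have h1 := Real.log_le_sub_one_of_pos (mul_pos hδ (by linarith : 0 < x))
  rw [Real.log_mul hδ.ne' (by linarith)] at h1
  linarith [neg_abs_le (Real.log δ)]

lemma isSublinear_log_sq : IsSublinear fun x ↦ Real.log x ^ 2 := fun δ hδ ↦ by
  obtain ⟨K, hK0, hK⟩ := isSublinear_log √(δ / 8) (by positivity)
  refine ⟨8 * K ^ 2, by positivity, fun x hx ↦ ?_⟩
  have h1 : 1 ≤ √x := Real.one_le_sqrt.2 hx
  have h2 := hK _ h1
  rw [abs_of_nonneg (Real.log_nonneg h1), Real.log_sqrt (by linarith)] at h2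
  rw [abs_of_nonneg (sq_nonneg _)]
  have h3 := pow_le_pow_left₀ (by linarith [Real.log_nonneg hx]) h2 2
  have h4 : (√(δ / 8) * √x) ^ 2 = δ / 8 * x := by
    rw [mul_pow, Real.sq_sqrt (by positivity), Real.sq_sqrt (by linarith)]
  nlinarith [sq_nonneg (√(δ / 8) * √x - K)]

lemma abs_harmonic_sub_le {y : ℝ} (hy : 1 ≤ y) :
    |y * (Real.log y + eulerMascheroniConstant - ∑ n ∈ Finset.Icc 1 ⌊y⌋₊, (n : ℝ)⁻¹)| ≤ 2 := by
  set N := ⌊y⌋₊ with hN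
  have hN1 : 1 ≤ N := Nat.one_le_floor_iff y |>.2 hy
  have hN1' : (1 : ℝ) ≤ N := by exact_mod_cast hN1
  have h1 := eulerMascheroniSeq_lt_eulerMascheroniConstant N
  have h2 := eulerMascheroniConstant_lt_eulerMascheroniSeq' N
  have hH : ((harmonic N : ℚ) : ℝ) = ∑ n ∈ Finset.Icc 1 N, (n : ℝ)⁻¹ := by
    rw [harmonic_eq_sum_Icc]; push_cast; rfl
  rw [eulerMascheroniSeq, hH] at h1
  rw [eulerMascheroniSeq', if_neg (by omega), hH] at h2
  have h3 : (N : ℝ) ≤ y := Nat.floor_le (by linarith)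
  have h4 : y < N + 1 := Nat.lt_floor_add_one y
  have h5 : Real.log N ≤ Real.log y := Real.log_le_log (by linarith) h3
  have h6 : Real.log y ≤ Real.log (N + 1) := Real.log_le_log (by linarith) h4.le
  have h7 : Real.log (N + 1) - Real.log N ≤ 1 / N := by
    rw [← Real.log_div (by linarith) (by linarith)]
    refine (Real.log_le_sub_one_of_pos (by positivity)).trans (le_of_eq ?_)
    field_simp; ring
  have h8 : y * (1 / N) ≤ 2 := by
    rw [mul_one_div, div_le_iff₀ (by linarith)]; linarith
  rw [abs_mul, abs_of_nonneg (by linarith : 0 ≤ y)]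
  refine le_trans (mul_le_mul_of_nonneg_left ?_ (by linarith)) h8
  rw [abs_le]
  constructor <;> linarith

lemma sum_inv_le {x : ℝ} (hx : 1 ≤ x) :
    ∑ n ∈ Finset.Icc 1 ⌊x⌋₊, (n : ℝ)⁻¹ ≤ 1 + Real.log x := by
  have h := harmonic_floor_le_one_add_log x hx
  rw [harmonic_eq_sum_Icc] at h
  push_cast at h
  exact h

lemma IsSublinear.dirichletSum_of_abs_le_one {r : ℝ → ℝ} (hr : IsSublinear r) {a : ℕ → ℝ}
    (ha : ∀ n, |a n| ≤ 1) : IsSublinearLog (dirichletSum a r) := fun δ hδ ↦ by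
  obtain ⟨K, hK0, hK⟩ := hr δ hδ
  refine ⟨δ + K, by positivity, fun x hx ↦ ?_⟩
  refine (abs_dirichletSum_le ha hK).trans ?_
  have h1 : dirichletSum (fun _ ↦ 1) (fun y ↦ δ * y + K) x =
      δ * x * ∑ n ∈ Finset.Icc 1 ⌊x⌋₊, (n : ℝ)⁻¹ + ⌊x⌋₊ * K := by
    simp [dirichletSum, Finset.sum_add_distrib, Finset.mul_sum, div_eq_mul_inv, mul_assoc]
  have h2 := mul_le_mul_of_nonneg_left (sum_inv_le hx) (by positivity : 0 ≤ δ * x)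
  have h3 := mul_le_mul_of_nonneg_right (Nat.floor_le (by linarith : 0 ≤ x)) hK0
  rw [h1]
  linarith

/-- Generalised Selberg formula: if `F(x) = ∑_{n ≤ x} f(x/n)` satisfies
`F(x) = A x log x + B x + C x / log x + o(x / log x)`, then `g(x) = f(x) - A x` satisfies
`g(x) log x + ∑_{n ≤ x} Λ(n) g(x/n) = o(x log x)`. -/
lemma isSublinearLog_log_mul_add_vonMangoldt {f : ℝ → ℝ} {A B C : ℝ}
    (hF : IsSublinear fun y ↦ Real.log y * dirichletSum (ζ : ArithmeticFunction ℝ) f y -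
      (A * y * Real.log y ^ 2 + B * y * Real.log y + C * y)) :
    IsSublinearLog fun x ↦ Real.log x * (f x - A * x) + dirichletSum Λ (fun y ↦ f y - A * y) x := by
  set γ := eulerMascheroniConstant
  let H : ℝ → ℝ := fun y ↦ ∑ n ∈ Finset.Icc 1 ⌊y⌋₊, (n : ℝ)⁻¹
  let E : ℝ → ℝ := fun y ↦ y * (Real.log y + γ - H y)
  have hE : ∀ y, 1 ≤ y → |E y| ≤ 2 := fun y hy ↦ abs_harmonic_sub_le hy
  have hZid : ∀ y, dirichletSum (ζ : ArithmeticFunction ℝ) (fun t ↦ t) y = y * H y := fun y ↦ by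
    simp [dirichletSum_zeta, H, Finset.mul_sum, div_eq_mul_inv]
  have hZone : ∀ y, dirichletSum (ζ : ArithmeticFunction ℝ) (fun _ ↦ 1) y = ⌊y⌋₊ := fun y ↦ by
    simp [dirichletSum_zeta]
  have hlogE : IsSublinear fun y ↦ Real.log y * E y := fun δ hδ ↦ by
    obtain ⟨K, hK0, hK⟩ := isSublinear_log.const_mul 2 δ hδ
    refine ⟨K, hK0, fun y hy ↦ le_trans ?_ (hK y hy)⟩
    rw [abs_mul (Real.log y), abs_mul (2 : ℝ), abs_two, mul_comm]
    exact mul_le_mul_of_nonneg_right (hE y hy) (abs_nonneg _)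
  have hfl : IsSublinear fun y : ℝ ↦ y - (⌊y⌋₊ : ℝ) := isSublinear_of_bounded 1 fun y hy ↦ by
    rw [abs_le]
    constructor <;> linarith [Nat.floor_le (by linarith : 0 ≤ y), Nat.lt_floor_add_one y]
  set B' := B - A * γ with hB'
  have hρ := ((hF.add (hlogE.const_mul A)).add
    ((isSublinear_of_bounded 2 hE).const_mul B')).add (hfl.const_mul (C - B' * γ))
  set ρ : ℝ → ℝ := _
  change IsSublinear ρ at hρ
  have hG : ∀ y, 1 ≤ y → Real.log y *
      dirichletSum (ζ : ArithmeticFunction ℝ) (fun y ↦ f y - A * y) y =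
      (B' * dirichletSum (ζ : ArithmeticFunction ℝ) (fun t ↦ t) y +
        (C - B' * γ) * dirichletSum (ζ : ArithmeticFunction ℝ) (fun _ ↦ 1) y) + ρ y := by
    intro y hy
    have h1 : dirichletSum (ζ : ArithmeticFunction ℝ) (fun y ↦ f y - A * y) y =
        dirichletSum (ζ : ArithmeticFunction ℝ) f y - A * (y * H y) := by
      rw [← hZid, ← dirichletSum_const_mul, eq_sub_iff_add_eq, ← dirichletSum_add]
      simp
    rw [h1, hZid, hZone]
    simp only [ρ, E, hB']
    ring
  have hμ : ∀ n, |((μ : ArithmeticFunction ℝ) n)| ≤ 1 := fun n ↦ by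
    rw [intCoe_apply]
    exact_mod_cast abs_moebius_le_one
  refine (((isSublinearLog_of_linear (|B'| + |C - B' * γ|) (r := fun x ↦ B' * x + (C - B' * γ))
    fun x hx ↦ ?_)).add (hρ.dirichletSum_of_abs_le_one hμ)).congr fun x hx ↦ ?_
  · refine (abs_add_le _ _).trans ?_
    rw [abs_mul, abs_of_nonneg (by linarith : 0 ≤ x)]
    nlinarith [abs_nonneg (C - B' * γ)]
  · rw [← moebius_dirichletSum_log_mul (fun y ↦ f y - A * y) hx, dirichletSum_congr hG, dirichletSum_add,
      dirichletSum_add, dirichletSum_const_mul, dirichletSum_const_mul,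
      moebius_dirichletSum_zeta _ hx, moebius_dirichletSum_zeta _ hx, mul_one]

lemma dirichletSum_vonMangoldt_one (x : ℝ) : dirichletSum Λ (fun _ ↦ 1) x = Chebyshev.psi x := by
  simp [dirichletSum, Chebyshev.psi, icc_one_eq_ioc_zero]

lemma log_four_add_four_nonneg : (0 : ℝ) ≤ Real.log 4 + 4 := by
  linarith [Real.log_nonneg (by norm_num : (1 : ℝ) ≤ 4)]

lemma sum_log_bounds {N : ℕ} (hN : 1 ≤ N) :
    N * Real.log N - N ≤ ∑ n ∈ Finset.Icc 1 N, Real.log n ∧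
      ∑ n ∈ Finset.Icc 1 N, Real.log n ≤ N * Real.log N - N + 1 + Real.log N := by
  induction N, hN using Nat.le_induction with
  | base => norm_num
  | succ N hN ih =>
    rw [Finset.sum_Icc_succ_top (by omega)]
    have hN' : (1 : ℝ) ≤ N := by exact_mod_cast hN
    have h1 : N * (Real.log (N + 1) - Real.log N) ≤ 1 := by
      rw [← Real.log_div (by linarith) (by linarith)]
      have := Real.log_le_sub_one_of_pos (by positivity : (0 : ℝ) < (N + 1) / N)
      have h2 := mul_le_mul_of_nonneg_left this (by linarith : (0 : ℝ) ≤ N)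
      refine h2.trans (le_of_eq ?_)
      field_simp; ring
    have h2 : 1 ≤ (N + 1) * (Real.log (N + 1) - Real.log N) := by
      rw [← Real.log_div (by linarith) (by linarith)]
      have := Real.one_sub_inv_le_log_of_pos (by positivity : (0 : ℝ) < (N + 1) / N)
      have h2 := mul_le_mul_of_nonneg_left this (by linarith : (0 : ℝ) ≤ N + 1)
      refine le_trans (le_of_eq ?_) h2
      field_simp; ring
    push_cast
    constructor <;> linarith [ih.1, ih.2]

lemma abs_sum_log_sub_le {x : ℝ} (hx : 1 ≤ x) :
    |∑ n ∈ Finset.Icc 1 ⌊x⌋₊, Real.log n - (x * Real.log x - x)| ≤ 2 + Real.log x := by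
  have hN : 1 ≤ ⌊x⌋₊ := Nat.one_le_floor_iff x |>.2 hx
  set N := ⌊x⌋₊
  have hN' : (1 : ℝ) ≤ N := by exact_mod_cast hN
  have h3 : (N : ℝ) ≤ x := Nat.floor_le (by linarith)
  have h4 : x < N + 1 := Nat.lt_floor_add_one x
  have h5 : Real.log N ≤ Real.log x := Real.log_le_log (by linarith) h3
  have h6 : N * (Real.log x - Real.log N) ≤ x - N := by
    rw [← Real.log_div (by linarith) (by linarith)]
    have := Real.log_le_sub_one_of_pos (by positivity : (0 : ℝ) < x / N)
    refine (mul_le_mul_of_nonneg_left this (by linarith : (0 : ℝ) ≤ N)).trans (le_of_eq ?_)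
    field_simp
  have h7 : 0 ≤ N * (Real.log x - Real.log N) := by nlinarith
  have h8 := Real.log_nonneg hx
  obtain ⟨hl, hu⟩ := sum_log_bounds hN
  rw [abs_le]
  constructor <;> nlinarith

lemma dirichletSum_zeta_psi (x : ℝ) :
    dirichletSum (ζ : ArithmeticFunction ℝ) Chebyshev.psi x =
      ∑ n ∈ Finset.Icc 1 ⌊x⌋₊, Real.log n := by
  have : Chebyshev.psi = dirichletSum Λ fun _ ↦ 1 := by
    ext x; rw [dirichletSum_vonMangoldt_one]
  rw [this, dirichletSum_comp, zeta_mul_vonMangoldt]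
  simp [dirichletSum, ArithmeticFunction.log_apply]

/-- Mertens' first theorem. -/
lemma exists_abs_dirichletSum_vonMangoldt_id_sub_le :
    ∃ c : ℝ, 0 ≤ c ∧ ∀ x : ℝ, 1 ≤ x → |dirichletSum Λ (fun y ↦ y) x - x * Real.log x| ≤ c * x := by
  refine ⟨Real.log 4 + 4 + 4, by linarith [log_four_add_four_nonneg], fun x hx ↦ ?_⟩
  have h1 : ∑ n ∈ Finset.Icc 1 ⌊x⌋₊, Real.log n =
      dirichletSum Λ (fun y ↦ (⌊y⌋₊ : ℝ)) x := by
    have h : (fun y : ℝ ↦ (⌊y⌋₊ : ℝ)) = dirichletSum (ζ : ArithmeticFunction ℝ) fun _ ↦ 1 := by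
      ext y; simp [dirichletSum_zeta]
    rw [h, dirichletSum_comp, vonMangoldt_mul_zeta]
    simp [dirichletSum, ArithmeticFunction.log_apply]
  have h2 : dirichletSum Λ (fun y ↦ (⌊y⌋₊ : ℝ)) x ≤ dirichletSum Λ (fun y ↦ y) x :=
    Finset.sum_le_sum fun n hn ↦ mul_le_mul_of_nonneg_left
      (Nat.floor_le (by linarith [(one_le_div_of_mem_icc hn).2.1])) vonMangoldt_nonneg
  have h3 : dirichletSum Λ (fun y ↦ y) x ≤
      dirichletSum Λ (fun y ↦ (⌊y⌋₊ : ℝ)) x + dirichletSum Λ (fun _ ↦ 1) x := by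
    rw [← dirichletSum_add]
    exact Finset.sum_le_sum fun n hn ↦ mul_le_mul_of_nonneg_left
      (Nat.lt_floor_add_one _).le vonMangoldt_nonneg
  rw [dirichletSum_vonMangoldt_one] at h3
  have h4 := Chebyshev.psi_le_const_mul_self (by linarith : 0 ≤ x)
  have h5 := abs_le.1 (abs_sum_log_sub_le hx)
  have h6 := Real.log_le_sub_one_of_pos (by linarith : 0 < x)
  rw [← h1] at h2 h3
  have h7 := mul_nonneg log_four_add_four_nonneg (by linarith : 0 ≤ x)
  rw [abs_le]
  constructor <;> linarith

lemma IsSublinear.dirichletSum_vonMangoldt {r : ℝ → ℝ} (hr : IsSublinear r) :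
    IsSublinearLog (dirichletSum Λ r) := fun δ hδ ↦ by
  obtain ⟨K, hK0, hK⟩ := hr δ hδ
  obtain ⟨c, hc0, hc⟩ := exists_abs_dirichletSum_vonMangoldt_id_sub_le
  have h0 := log_four_add_four_nonneg
  refine ⟨δ * c + K * (Real.log 4 + 4), by positivity, fun x hx ↦ ?_⟩
  refine (abs_dirichletSum_le (fun n ↦ (abs_of_nonneg vonMangoldt_nonneg).le) hK).trans ?_
  have h1 := dirichletSum_const_mul Λ K (fun _ ↦ 1) x
  simp only [mul_one] at h1
  rw [dirichletSum_add, dirichletSum_const_mul, h1, dirichletSum_vonMangoldt_one]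
  have h2 := mul_le_mul_of_nonneg_left (abs_le.1 (hc x hx)).2 hδ.le
  have h3 := mul_le_mul_of_nonneg_left
    (Chebyshev.psi_le_const_mul_self (by linarith : 0 ≤ x)) hK0
  linarith

/-- Selberg's symmetry formula with error term `o(x log x)`. -/
lemma isSublinearLog_selberg : IsSublinearLog fun x ↦
    ∑ n ∈ Finset.Icc 1 ⌊x⌋₊, (Λ n * Real.log n + (Λ * Λ) n) - 2 * (x * Real.log x) := by
  have hψ : IsSublinear fun y ↦ Real.log y *
      dirichletSum (ζ : ArithmeticFunction ℝ) Chebyshev.psi y -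
      (1 * y * Real.log y ^ 2 + (-1) * y * Real.log y + 0 * y) := fun δ hδ ↦ by
    obtain ⟨K, hK0, hK⟩ := ((isSublinear_log.const_mul 2).add isSublinear_log_sq) δ hδ
    refine ⟨K, hK0, fun y hy ↦ le_trans ?_ (hK y hy)⟩
    have h0 := Real.log_nonneg hy
    beta_reduce
    rw [dirichletSum_zeta_psi, abs_of_nonneg (by positivity : 0 ≤ 2 * Real.log y + Real.log y ^ 2)]
    have := mul_le_mul_of_nonneg_left (abs_sum_log_sub_le hy) h0
    rw [← abs_of_nonneg h0, ← abs_mul, abs_of_nonneg h0] at this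
    refine le_trans (le_of_eq ?_) (this.trans (le_of_eq ?_))
    · congr 1; ring
    · ring
  have h1 := isSublinearLog_log_mul_add_vonMangoldt hψ
  obtain ⟨c, -, hc⟩ := exists_abs_dirichletSum_vonMangoldt_id_sub_le
  refine ((h1.add (isSublinearLog_of_linear c hc)).add
    (isSublinear_log.dirichletSum_vonMangoldt.const_mul (-1))).congr fun x hx ↦ ?_
  have h2 : dirichletSum Λ (fun y ↦ Chebyshev.psi y - 1 * y) x =
      dirichletSum Λ Chebyshev.psi x - dirichletSum Λ (fun y ↦ y) x := by
    rw [eq_sub_iff_add_eq, ← dirichletSum_add]; simp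
  have h3 : dirichletSum Λ Chebyshev.psi x = ∑ n ∈ Finset.Icc 1 ⌊x⌋₊, (Λ * Λ) n := by
    have : Chebyshev.psi = dirichletSum Λ fun _ ↦ 1 := by
      ext x; rw [dirichletSum_vonMangoldt_one]
    rw [this, dirichletSum_comp]
    simp [dirichletSum]
  have h4 : Real.log x * Chebyshev.psi x =
      ∑ n ∈ Finset.Icc 1 ⌊x⌋₊, Λ n * Real.log n + dirichletSum Λ Real.log x := by
    rw [← dirichletSum_vonMangoldt_one, dirichletSum, dirichletSum, ← Finset.sum_add_distrib,
      Finset.mul_sum]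
    refine Finset.sum_congr rfl fun n hn ↦ ?_
    have := (one_le_div_of_mem_icc hn).1
    rw [Real.log_div (by linarith) (by linarith)]
    ring
  rw [h2, h3, Finset.sum_add_distrib]
  linarith

lemma abs_sum_mul_sub_le {c U V M : ℕ → ℝ} {N : ℕ} (hN : 1 ≤ N)
    (hM : ∀ n, 1 ≤ n → |∑ k ∈ Finset.Icc 1 n, c k| ≤ M n)
    (hUV : ∀ n, 1 ≤ n → n < N → |U n - U (n + 1)| ≤ V n - V (n + 1)) :
    |∑ k ∈ Finset.Icc 1 N, c k * U k - (∑ k ∈ Finset.Icc 1 N, c k) * U N| ≤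
      ∑ n ∈ Finset.Ico 1 N, M n * (V n - V (n + 1)) := by
  induction N, hN using Nat.le_induction with
  | base => simp
  | succ N hN ih =>
    have ih := ih fun n h1 h2 ↦ hUV n h1 (by omega)
    rw [Finset.sum_Icc_succ_top (by omega), Finset.sum_Icc_succ_top (by omega),
      Finset.sum_Ico_succ_top hN]
    have h1 : |(∑ k ∈ Finset.Icc 1 N, c k) * (U N - U (N + 1))| ≤ M N * (V N - V (N + 1)) := by
      rw [abs_mul]
      exact mul_le_mul (hM N hN) (hUV N hN (by omega)) (abs_nonneg _)
        ((abs_nonneg _).trans (hM N hN))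
    refine le_trans (le_of_eq ?_) ((abs_add_le _ _).trans (add_le_add ih h1))
    congr 1; ring

/-- Weights of Selberg's formula, of average order `2`. -/
noncomputable def selbergWeight (n : ℕ) : ℝ := Λ n + (Λ * Λ) n / Real.log n

lemma vonMangoldt_mul_self_nonneg (n : ℕ) : 0 ≤ (Λ * Λ) n := by
  rw [ArithmeticFunction.mul_apply]
  exact Finset.sum_nonneg fun _ _ ↦ mul_nonneg vonMangoldt_nonneg vonMangoldt_nonneg

lemma exists_abs_sum_selberg_le {δ : ℝ} (hδ : 0 < δ) : ∃ K, 0 ≤ K ∧ ∀ N : ℕ, 1 ≤ N →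
    |∑ n ∈ Finset.Icc 1 N, (Λ n * Real.log n + (Λ * Λ) n - 2 * Real.log n)| ≤
      δ * (N * Real.log N) + K := by
  obtain ⟨K, hK0, hK⟩ := isSublinearLog_selberg (δ / 2) (by positivity)
  set L := K + 6
  have hL : 0 < L := by positivity
  refine ⟨L * Real.exp (2 * L / δ), by positivity, fun N hN ↦ ?_⟩
  have hN' : (1 : ℝ) ≤ N := by exact_mod_cast hN
  have h1 := hK N hN'
  beta_reduce at h1
  rw [Nat.floor_natCast] at h1
  have h2 := abs_sum_log_sub_le hN'
  rw [Nat.floor_natCast] at h2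
  have h3 := Real.log_le_sub_one_of_pos (by linarith : (0 : ℝ) < N)
  have h4 : |∑ n ∈ Finset.Icc 1 N, (Λ n * Real.log n + (Λ * Λ) n - 2 * Real.log n)| ≤
      δ / 2 * (N * Real.log N) + L * N := by
    rw [Finset.sum_sub_distrib, ← Finset.mul_sum]
    rw [abs_le] at h1 h2 ⊢
    constructor <;> linarith [h1.1, h1.2, h2.1, h2.2]
  refine h4.trans ?_
  rcases le_total (N : ℝ) (Real.exp (2 * L / δ)) with h | h
  · have h5 := mul_le_mul_of_nonneg_left h hL.le
    have h6 : 0 ≤ δ / 2 * (N * Real.log N) := by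
      have := Real.log_natCast_nonneg N
      positivity
    linarith
  · have h5 : 2 * L / δ ≤ Real.log N := (Real.le_log_iff_exp_le (by linarith)).2 h
    rw [div_le_iff₀ hδ] at h5
    have h6 : 0 ≤ L * Real.exp (2 * L / δ) := by positivity
    nlinarith

lemma exists_abs_sum_selbergWeight_sub_le {δ : ℝ} (hδ : 0 < δ) : ∃ K, 0 ≤ K ∧ ∀ N : ℕ, 1 ≤ N →
    |∑ n ∈ Finset.Icc 1 N, (selbergWeight n - 2)| ≤ δ * N + K := by
  have hl2 : 0 < Real.log 2 := Real.log_pos one_lt_two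
  obtain ⟨K, hK0, hK⟩ := exists_abs_sum_selberg_le (δ := δ * Real.log 2 / 2) (by positivity)
  set δ' := δ * Real.log 2 / 2
  refine ⟨K / Real.log 2 + 2, by positivity, fun N hN ↦ ?_⟩
  let U : ℕ → ℝ := fun n ↦ (Real.log (max n 2 : ℕ))⁻¹
  let e : ℕ → ℝ := fun n ↦ Λ n * Real.log n + (Λ * Λ) n - 2 * Real.log n
  have hlog : ∀ n : ℕ, Real.log 2 ≤ Real.log (max n 2 : ℕ) := fun n ↦
    Real.log_le_log (by norm_num) (by exact_mod_cast le_max_right n 2)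
  have hU0 : ∀ n, 0 ≤ U n := fun n ↦ inv_nonneg.2 (hl2.le.trans (hlog n))
  have hU : ∀ n, U (n + 1) ≤ U n := fun n ↦ inv_anti₀ (hl2.trans_le (hlog n))
    (Real.log_le_log (by positivity) (by exact_mod_cast max_le_max (Nat.le_succ n) le_rfl))
  have hstep : ∀ n : ℕ, 1 ≤ n → n * Real.log n * (U n - U (n + 1)) ≤ (Real.log 2)⁻¹ := by
    intro n hn
    rcases eq_or_lt_of_le hn with rfl | hn
    · simpa using hl2.le
    · have hn' : (2 : ℝ) ≤ n := by exact_mod_cast (show 2 ≤ n from hn)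
      have h1 : Real.log 2 ≤ Real.log n := Real.log_le_log (by norm_num) hn'
      have h2 : Real.log n ≤ Real.log (n + 1) := Real.log_le_log (by linarith) (by linarith)
      have h3 : n * (Real.log (n + 1) - Real.log n) ≤ 1 := by
        rw [← Real.log_div (by linarith) (by linarith)]
        have := Real.log_le_sub_one_of_pos (by positivity : (0 : ℝ) < (n + 1) / n)
        refine (mul_le_mul_of_nonneg_left this (by linarith : (0 : ℝ) ≤ n)).trans (le_of_eq ?_)
        field_simp; ring
      have h4 : n * Real.log n * (U n - U (n + 1)) =
          n * (Real.log (n + 1) - Real.log n) * (Real.log (n + 1))⁻¹ := by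
        simp only [U]
        rw [max_eq_left hn, max_eq_left (by omega)]
        push_cast
        have : Real.log n ≠ 0 := by linarith
        have : Real.log (n + 1) ≠ 0 := by linarith
        field_simp
      rw [h4]
      refine (mul_le_mul_of_nonneg_right h3 (inv_nonneg.2 (by linarith))).trans ?_
      rw [one_mul]
      exact inv_anti₀ hl2 (by linarith)
  have hsum : ∑ n ∈ Finset.Icc 1 N, (selbergWeight n - 2) =
      ∑ n ∈ Finset.Icc 1 N, e n * U n - 2 := by
    have h : ∀ n ∈ Finset.Icc 1 N, selbergWeight n - 2 = e n * U n - if n = 1 then 2 else 0 := by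
      intro n hn
      rcases eq_or_lt_of_le (Finset.mem_Icc.1 hn).1 with rfl | hn
      · simp [selbergWeight, e, ArithmeticFunction.mul_apply]
      · have hn' : (1 : ℝ) < n := by exact_mod_cast hn
        have := (Real.log_pos hn').ne'
        simp only [selbergWeight, e, U]
        rw [max_eq_left (by omega), if_neg (by omega)]
        field_simp
        ring
    rw [Finset.sum_congr rfl h, Finset.sum_sub_distrib, Finset.sum_ite_eq' _ 1,
      if_pos (Finset.mem_Icc.2 ⟨le_rfl, hN⟩)]
  have hab := abs_sum_mul_sub_le (U := U) (V := U) hN hK fun n _ _ ↦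
    (abs_of_nonneg (sub_nonneg.2 (hU n))).le
  have hδ' : 0 ≤ δ' := by positivity
  have hbound : ∑ n ∈ Finset.Ico 1 N, (δ' * (n * Real.log n) + K) * (U n - U (n + 1)) ≤
      δ' * (Real.log 2)⁻¹ * (N - 1 : ℕ) + K * (U 1 - U N) := by
    have htel : ∑ n ∈ Finset.Ico 1 N, (U n - U (n + 1)) = U 1 - U N := by
      have := Finset.sum_Ico_sub U hN
      rw [← neg_inj, ← Finset.sum_neg_distrib]
      simpa using this
    rw [← htel, Finset.mul_sum]
    have : δ' * (Real.log 2)⁻¹ * (N - 1 : ℕ) = ∑ n ∈ Finset.Ico 1 N, δ' * (Real.log 2)⁻¹ := by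
      simp [mul_comm]
    rw [this, ← Finset.sum_add_distrib]
    refine Finset.sum_le_sum fun n hn ↦ ?_
    have := mul_le_mul_of_nonneg_left (hstep n (Finset.mem_Ico.1 hn).1) hδ'
    linarith
  have hlast : |(∑ n ∈ Finset.Icc 1 N, e n) * U N| ≤ δ' * N + K * U N := by
    rw [abs_mul, abs_of_nonneg (hU0 N)]
    refine (mul_le_mul_of_nonneg_right (hK N hN) (hU0 N)).trans ?_
    have h1 : Real.log N * U N ≤ 1 := by
      have h2 : Real.log N ≤ Real.log (max N 2 : ℕ) :=
        Real.log_le_log (by positivity) (by exact_mod_cast le_max_left N 2)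
      have h3 := mul_le_mul_of_nonneg_right h2 (hU0 N)
      rwa [mul_inv_cancel₀ (by linarith [hlog N])] at h3
    have h2 : 0 ≤ δ' * N := by positivity
    have h3 := mul_le_mul_of_nonneg_left h1 h2
    linarith
  have htri := (abs_sub_abs_le_abs_sub _ _).trans (hab.trans hbound)
  have hU1 : U 1 = (Real.log 2)⁻¹ := by simp [U]
  have hδ2 : δ' * (Real.log 2)⁻¹ = δ / 2 := by simp only [δ']; field_simp
  have hlog2 : Real.log 2 ≤ 1 := by
    linarith [Real.log_le_sub_one_of_pos (zero_lt_two (α := ℝ))]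
  have hN1 : ((N - 1 : ℕ) : ℝ) ≤ N := by exact_mod_cast Nat.sub_le N 1
  have h1 : δ / 2 * ((N - 1 : ℕ) : ℝ) ≤ δ / 2 * N := mul_le_mul_of_nonneg_left hN1 (by positivity)
  have h2 : δ' * N ≤ δ / 2 * N := by
    refine mul_le_mul_of_nonneg_right ?_ (by positivity)
    simp only [δ']; nlinarith
  have h3 := abs_sub (∑ n ∈ Finset.Icc 1 N, e n * U n) 2
  rw [hU1, hδ2] at htri
  rw [abs_two] at h3
  rw [hsum, div_eq_mul_inv]
  linarith

/-- If `u` varies no faster than a non-negative non-decreasing `v(x) = O(x)`, then the weights of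
Selberg's formula may be replaced by the constant `2` in sums of `u`. -/
lemma isSublinearLog_dirichletSum_selbergWeight_sub {u v : ℝ → ℝ} {L : ℝ}
    (hv : ∀ x, 1 ≤ x → v x ≤ L * x) (huv : ∀ x, 1 ≤ x → |u x| ≤ v x)
    (hmono : ∀ x y, 1 ≤ x → x ≤ y → |u y - u x| ≤ v y - v x) :
    IsSublinearLog (dirichletSum (fun n ↦ selbergWeight n - 2) u) := fun δ hδ ↦ by
  have hL : 0 ≤ L := by simpa using ((abs_nonneg _).trans (huv 1 le_rfl)).trans (hv 1 le_rfl)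
  obtain ⟨K, hK0, hK⟩ := exists_abs_sum_selbergWeight_sub_le (δ := δ / (L + 1)) (by positivity)
  set δ' := δ / (L + 1)
  have hδ' : 0 ≤ δ' := by positivity
  have hδL : δ' * L ≤ δ := by
    simp only [δ']
    rw [div_mul_eq_mul_div, div_le_iff₀ (by positivity)]
    nlinarith
  refine ⟨δ + K * L, by positivity, fun x hx ↦ ?_⟩
  have hN : 1 ≤ ⌊x⌋₊ := Nat.one_le_floor_iff x |>.2 hx
  have habel : ∀ M : ℕ, 1 ≤ M → ∑ n ∈ Finset.Ico 1 M, (δ' * n + K) *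
      (v (x / n) - v (x / (n + 1 : ℕ))) + (δ' * M + K) * v (x / M) =
      δ' * ∑ n ∈ Finset.Icc 1 M, v (x / n) + K * v x := by
    intro M hM
    induction M, hM using Nat.le_induction with
    | base => simp; ring
    | succ M hM ih =>
      rw [Finset.sum_Ico_succ_top hM, Finset.sum_Icc_succ_top (by omega)]
      push_cast at ih ⊢
      linarith
  have hdiff : ∀ n, 1 ≤ n → n < ⌊x⌋₊ → |u (x / n) - u (x / (n + 1 : ℕ))| ≤
      v (x / n) - v (x / (n + 1 : ℕ)) := fun n h1 h2 ↦ by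
    refine hmono _ _ (one_le_div_of_mem_icc (Finset.mem_Icc.2 ⟨by omega, by omega⟩)).2.1 ?_
    have : (0 : ℝ) < n := by exact_mod_cast h1
    exact div_le_div_of_nonneg_left (by linarith) this (by push_cast; linarith)
  have h1 := abs_sum_mul_sub_le (U := fun n ↦ u (x / n)) (V := fun n ↦ v (x / n)) hN hK hdiff
  have h2 : |(∑ k ∈ Finset.Icc 1 ⌊x⌋₊, (selbergWeight k - 2)) * u (x / ⌊x⌋₊)| ≤
      (δ' * ⌊x⌋₊ + K) * v (x / ⌊x⌋₊) := by
    rw [abs_mul]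
    exact mul_le_mul (hK _ hN)
      (huv _ (one_le_div_of_mem_icc (Finset.mem_Icc.2 ⟨hN, le_rfl⟩)).2.1) (abs_nonneg _)
      (by positivity)
  have h3 : ∑ n ∈ Finset.Icc 1 ⌊x⌋₊, v (x / n) ≤ L * x * (1 + Real.log x) := by
    refine le_trans ?_ (mul_le_mul_of_nonneg_left (sum_inv_le hx) (by positivity))
    rw [Finset.mul_sum]
    refine Finset.sum_le_sum fun n hn ↦ (hv _ (one_le_div_of_mem_icc hn).2.1).trans (le_of_eq ?_)
    rw [div_eq_mul_inv, mul_assoc]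
  have h4 := (abs_sub_abs_le_abs_sub _ _).trans h1
  have h5 := habel _ hN
  have h6 := mul_le_mul_of_nonneg_left h3 hδ'
  have h7 := mul_le_mul_of_nonneg_left (hv x hx) hK0
  have h8 : 0 ≤ x * (1 + Real.log x) := by
    have := Real.log_nonneg hx
    positivity
  have h9 := mul_le_mul_of_nonneg_right hδL h8
  simp only [dirichletSum]
  linarith

lemma sum_le_integral_add {u v : ℝ → ℝ} (huv : ∀ x, 1 ≤ x → |u x| ≤ v x)
    (hu : ∀ x, 1 ≤ x → 0 ≤ u x) (hmono : ∀ x y, 1 ≤ x → x ≤ y → |u y - u x| ≤ v y - v x)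
    (hint : ∀ a b, 1 ≤ a → a ≤ b → IntervalIntegrable (fun t ↦ u t / t ^ 2) MeasureTheory.volume a b)
    {x : ℝ} (hx : 1 ≤ x) :
    ∑ n ∈ Finset.Icc 1 ⌊x⌋₊, u (x / n) ≤ x * (∫ t in (1 : ℝ)..x, u t / t ^ 2) + v x := by
  have hN : 1 ≤ ⌊x⌋₊ := Nat.one_le_floor_iff x |>.2 hx
  have hstep : ∀ M : ℕ, 1 ≤ M → M ≤ ⌊x⌋₊ → ∑ n ∈ Finset.Icc 1 M, u (x / n) ≤
      x * (∫ t in (x / M)..x, u t / t ^ 2) + v x - v (x / M) + u (x / M) := by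
    intro M hM
    induction M, hM using Nat.le_induction with
    | base => simp
    | succ M hM ih =>
      intro hM1
      have ih := ih (by omega)
      rw [Finset.sum_Icc_succ_top (by omega)]
      obtain ⟨hM0, -, hbx⟩ := one_le_div_of_mem_icc
        (Finset.mem_Icc.2 ⟨hM, by omega⟩ : M ∈ Finset.Icc 1 ⌊x⌋₊)
      obtain ⟨-, ha1, -⟩ := one_le_div_of_mem_icc
        (Finset.mem_Icc.2 ⟨by omega, hM1⟩ : M + 1 ∈ Finset.Icc 1 ⌊x⌋₊)
      have hab : x / (M + 1 : ℕ) ≤ x / M :=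
        div_le_div_of_nonneg_left (by linarith) (by linarith) (by push_cast; linarith)
      have hdiff : x * ((x / (M + 1 : ℕ))⁻¹ - (x / M)⁻¹) = 1 := by
        push_cast
        have : x ≠ 0 := by linarith
        field_simp
        ring
      set a := x / (M + 1 : ℕ)
      set b := x / M
      have h0 : (0 : ℝ) ∉ Set.uIcc a b := by
        rw [Set.uIcc_of_le hab, Set.mem_Icc]
        intro h
        linarith [h.1]
      have hc : ∫ t in a..b, (u b - (v b - v a)) / t ^ 2 =
          (u b - (v b - v a)) * (a⁻¹ - b⁻¹) := by
        have h1 := integral_zpow (a := a) (b := b) (n := -2) (Or.inr ⟨by norm_num, h0⟩)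
        norm_num at h1
        simp only [div_eq_mul_inv]
        rw [intervalIntegral.integral_const_mul]
        congr 1
        convert h1 using 1
        ring
      have hle : ∫ t in a..b, (u b - (v b - v a)) / t ^ 2 ≤ ∫ t in a..b, u t / t ^ 2 := by
        refine intervalIntegral.integral_mono_on hab ?_ (hint a b ha1 hab) fun t ht ↦ ?_
        · refine ContinuousOn.intervalIntegrable fun t ht ↦ ContinuousAt.continuousWithinAt ?_
          have : t ^ 2 ≠ 0 := pow_ne_zero 2 fun h ↦ h0 (h ▸ ht)
          fun_prop (disch := assumption)
        · have h1 := abs_le.1 (hmono t b (by linarith [ht.1]) ht.2)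
          have h2 := (abs_nonneg _).trans (hmono a t ha1 ht.1)
          gcongr
          linarith
      have hadd := intervalIntegral.integral_add_adjacent_intervals (hint a b ha1 hab)
        (hint b x (by linarith) hbx)
      have h1 := mul_le_mul_of_nonneg_left hle (by linarith : 0 ≤ x)
      rw [hc, mul_left_comm, hdiff] at h1
      rw [← hadd]
      linarith
  have hNx := one_le_div_of_mem_icc (Finset.mem_Icc.2 ⟨hN, le_rfl⟩)
  have h1 := hstep _ hN le_rfl
  have h2 := (le_abs_self _).trans (huv _ hNx.2.1)
  have hadd := intervalIntegral.integral_add_adjacent_intervals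
    (hint 1 (x / ⌊x⌋₊) le_rfl hNx.2.1) (hint _ x hNx.2.1 hNx.2.2)
  have h3 : 0 ≤ ∫ t in (1 : ℝ)..(x / ⌊x⌋₊), u t / t ^ 2 :=
    intervalIntegral.integral_nonneg hNx.2.1 fun t ht ↦ div_nonneg (hu t ht.1) (sq_nonneg t)
  have h4 := mul_nonneg (by linarith : 0 ≤ x) h3
  rw [← hadd]
  linarith

lemma isSublinear_of_asymptotic {f : ℝ → ℝ} {A B C : ℝ}
    (hnonneg : ∀ x, 1 ≤ x → 0 ≤ f x) (hmono : ∀ x y, 1 ≤ x → x ≤ y → f x ≤ f y)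
    (hF : (fun x : ℝ ↦ (∑ n ∈ Finset.Icc 1 ⌊x⌋₊, f (x / n)) -
      (A * x * Real.log x + B * x + C * x / Real.log x)) =o[atTop] fun x : ℝ ↦ x / Real.log x) :
    IsSublinear fun y ↦ Real.log y * dirichletSum (ζ : ArithmeticFunction ℝ) f y -
      (A * y * Real.log y ^ 2 + B * y * Real.log y + C * y) := by
  refine isSublinear_of_isLittleO ?_ fun Y ↦ ?_
  · refine ((Asymptotics.isBigO_refl Real.log atTop).mul_isLittleO hF).congr' ?_ ?_
    · filter_upwards [eventually_gt_atTop 1] with x hx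
      have := (Real.log_pos hx).ne'
      rw [dirichletSum_zeta]
      field_simp
    · filter_upwards [eventually_gt_atTop 1] with x hx
      have := (Real.log_pos hx).ne'
      field_simp
  · refine ⟨Real.log Y * (Y * f Y) +
      (|A| * Y * Real.log Y ^ 2 + |B| * Y * Real.log Y + |C| * Y), fun y hy hyY ↦ ?_⟩
    have h0 := Real.log_nonneg hy
    have h1 : Real.log y ≤ Real.log Y := Real.log_le_log (by linarith) hyY
    have hf0 := hnonneg Y (hy.trans hyY)
    have hlY : 0 ≤ Real.log Y := h0.trans h1
    have hY0 : 0 ≤ Y := by linarith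
    have h2 : |dirichletSum (ζ : ArithmeticFunction ℝ) f y| ≤ Y * f Y := by
      rw [dirichletSum_zeta, abs_of_nonneg (Finset.sum_nonneg fun n hn ↦
        hnonneg _ (one_le_div_of_mem_icc hn).2.1)]
      refine (Finset.sum_le_card_nsmul _ _ (f Y) fun n hn ↦ ?_).trans ?_
      · have := one_le_div_of_mem_icc hn
        exact hmono _ _ this.2.1 (this.2.2.trans hyY)
      · rw [Nat.card_Icc, nsmul_eq_mul, Nat.add_sub_cancel]
        exact mul_le_mul_of_nonneg_right ((Nat.floor_le (by linarith)).trans hyY) hf0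
    refine (abs_sub _ _).trans (add_le_add ?_ ((abs_add_le _ _).trans (add_le_add
      ((abs_add_le _ _).trans (add_le_add ?_ ?_)) ?_)))
    · rw [abs_mul, abs_of_nonneg h0]; gcongr
    · rw [abs_mul (A * y), abs_mul A, abs_of_nonneg (by linarith : 0 ≤ y),
        abs_of_nonneg (sq_nonneg (Real.log y))]
      gcongr
    · rw [abs_mul, abs_mul, abs_of_nonneg (by linarith : 0 ≤ y), abs_of_nonneg h0]
      gcongr
    · rw [abs_mul, abs_of_nonneg (by linarith : 0 ≤ y)]
      gcongr

lemma exists_le_mul_of_isSublinear {f : ℝ → ℝ} {A B C : ℝ}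
    (hnonneg : ∀ x, 1 ≤ x → 0 ≤ f x) (hmono : ∀ x y, 1 ≤ x → x ≤ y → f x ≤ f y)
    (hF : IsSublinear fun y ↦ Real.log y * dirichletSum (ζ : ArithmeticFunction ℝ) f y -
      (A * y * Real.log y ^ 2 + B * y * Real.log y + C * y)) :
    ∃ L, 0 ≤ L ∧ ∀ x, 1 ≤ x → f x ≤ L * x := by
  obtain ⟨K, hK0, hK⟩ := isSublinearLog_log_mul_add_vonMangoldt hF 1 one_pos
  obtain ⟨c, hc0, hc⟩ := exists_abs_dirichletSum_vonMangoldt_id_sub_le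
  have he : 1 ≤ Real.exp 1 := Real.one_le_exp zero_le_one
  have hfe := hnonneg _ he
  refine ⟨1 + K + 2 * |A| + |A| * c + f (Real.exp 1), by positivity, fun x hx ↦ ?_⟩
  rcases le_total x (Real.exp 1) with hxe | hxe
  · have h1 := hmono x _ hx hxe
    have h2 : 0 ≤ (1 + K + 2 * |A| + |A| * c) * x := by positivity
    nlinarith
  · have hl : 1 ≤ Real.log x := (Real.le_log_iff_exp_le (by linarith)).2 hxe
    have h1 := (abs_le.1 (hK x hx)).2
    beta_reduce at h1
    have h2 : dirichletSum Λ (fun y ↦ f y - A * y) x =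
        dirichletSum Λ f x - A * dirichletSum Λ (fun y ↦ y) x := by
      rw [← dirichletSum_const_mul, eq_sub_iff_add_eq, ← dirichletSum_add]; simp
    have h3 : 0 ≤ dirichletSum Λ f x := Finset.sum_nonneg fun n hn ↦
      mul_nonneg vonMangoldt_nonneg (hnonneg _ (one_le_div_of_mem_icc hn).2.1)
    have h4 : A * dirichletSum Λ (fun y ↦ y) x ≤ |A| * (x * Real.log x + c * x) := by
      refine (le_abs_self _).trans ?_
      rw [abs_mul]
      gcongr
      refine abs_le.2 ⟨?_, by linarith [(abs_le.1 (hc x hx)).2]⟩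
      have := abs_le.1 (hc x hx)
      have : 0 ≤ x * Real.log x := by positivity
      linarith
    have h5 : A * (x * Real.log x) ≤ |A| * (x * Real.log x) :=
      mul_le_mul_of_nonneg_right (le_abs_self A) (by positivity)
    have h6 : f x * Real.log x ≤ (1 + 2 * |A|) * (x * Real.log x) + (K + |A| * c) * x := by
      rw [h2] at h1
      linarith
    have h7 : (K + |A| * c) * x ≤ (K + |A| * c) * x * Real.log x :=
      le_mul_of_one_le_right (by positivity) hl
    have h8 : f x * Real.log x ≤ ((1 + K + 2 * |A| + |A| * c) * x) * Real.log x := by linarith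
    have h9 := le_of_mul_le_mul_right h8 (by linarith)
    have h10 : 0 ≤ f (Real.exp 1) * x := by positivity
    linarith

lemma isSublinearLog_dirichletSum_zeta {f : ℝ → ℝ} {A B C L : ℝ}
    (hnonneg : ∀ x, 1 ≤ x → 0 ≤ f x) (hL : ∀ x, 1 ≤ x → f x ≤ L * x)
    (hF : IsSublinear fun y ↦ Real.log y * dirichletSum (ζ : ArithmeticFunction ℝ) f y -
      (A * y * Real.log y ^ 2 + B * y * Real.log y + C * y)) :
    IsSublinearLog (dirichletSum (ζ : ArithmeticFunction ℝ) fun y ↦ f y - A * y) := by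
  obtain ⟨K, hK0, hK⟩ := hF 1 one_pos
  have hL0 : 0 ≤ L := by simpa using (hnonneg 1 le_rfl).trans (hL 1 le_rfl)
  refine isSublinearLog_of_linear (|B| + |C| + 1 + K + 2 * L + 3 * |A|) fun y hy ↦ ?_
  have hl0 := Real.log_nonneg hy
  have hH1 : Real.log y ≤ ∑ n ∈ Finset.Icc 1 ⌊y⌋₊, (n : ℝ)⁻¹ := by
    have h := log_le_harmonic_floor y (by linarith)
    rw [harmonic_eq_sum_Icc] at h
    push_cast at h
    exact h
  have hH2 := sum_inv_le hy
  have hFb : |dirichletSum (ζ : ArithmeticFunction ℝ) f y - A * (y * Real.log y)| ≤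
      (|B| + |C| + 1 + K + 2 * L + |A|) * y := by
    rcases le_total 1 (Real.log y) with hl | hl
    · have h1 : Real.log y * |dirichletSum (ζ : ArithmeticFunction ℝ) f y - A * (y * Real.log y)| ≤
          Real.log y * ((|B| + |C| + 1 + K) * y) := by
        rw [← abs_of_nonneg hl0, ← abs_mul, abs_of_nonneg hl0]
        have h2 : Real.log y *
            (dirichletSum (ζ : ArithmeticFunction ℝ) f y - A * (y * Real.log y)) =
            (Real.log y * dirichletSum (ζ : ArithmeticFunction ℝ) f y -
              (A * y * Real.log y ^ 2 + B * y * Real.log y + C * y)) +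
            (B * (y * Real.log y) + C * y) := by ring
        rw [h2]
        refine (abs_add_le _ _).trans ((add_le_add (hK y hy) (abs_add_le _ _)).trans ?_)
        rw [abs_mul B, abs_mul C, abs_of_nonneg (by positivity : 0 ≤ y * Real.log y),
          abs_of_nonneg (by linarith : 0 ≤ y)]
        have h3 : y ≤ y * Real.log y := le_mul_of_one_le_right (by linarith) hl
        have h4 : |C| * y ≤ |C| * (y * Real.log y) := by gcongr
        have h5 : K ≤ K * (y * Real.log y) := le_mul_of_one_le_right hK0 (by linarith)
        linarith
      refine (le_of_mul_le_mul_left h1 (by linarith)).trans ?_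
      exact mul_le_mul_of_nonneg_right (by linarith [abs_nonneg A]) (by linarith)
    · have h1 : |dirichletSum (ζ : ArithmeticFunction ℝ) f y| ≤ L * y * 2 := by
        rw [dirichletSum_zeta, abs_of_nonneg (Finset.sum_nonneg fun n hn ↦
          hnonneg _ (one_le_div_of_mem_icc hn).2.1)]
        refine le_trans ?_ (mul_le_mul_of_nonneg_left (by linarith : _ ≤ (2 : ℝ)) (by positivity))
        rw [Finset.mul_sum]
        refine Finset.sum_le_sum fun n hn ↦
          (hL _ (one_le_div_of_mem_icc hn).2.1).trans (le_of_eq ?_)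
        rw [div_eq_mul_inv, mul_assoc]
      have h2 : |A * (y * Real.log y)| ≤ |A| * y := by
        rw [abs_mul, abs_of_nonneg (by positivity : 0 ≤ y * Real.log y)]
        gcongr
        exact mul_le_of_le_one_right (by linarith) hl
      refine (abs_sub _ _).trans ((add_le_add h1 h2).trans ?_)
      have : 0 ≤ (|B| + |C| + 1 + K) * y := by positivity
      linarith
  have h1 : dirichletSum (ζ : ArithmeticFunction ℝ) (fun y ↦ f y - A * y) y =
      (dirichletSum (ζ : ArithmeticFunction ℝ) f y - A * (y * Real.log y)) +
        A * (y * (Real.log y - ∑ n ∈ Finset.Icc 1 ⌊y⌋₊, (n : ℝ)⁻¹)) := by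
    simp only [dirichletSum_zeta, Finset.sum_sub_distrib, ← Finset.mul_sum, div_eq_mul_inv]
    ring
  have h2 : |A * (y * (Real.log y - ∑ n ∈ Finset.Icc 1 ⌊y⌋₊, (n : ℝ)⁻¹))| ≤ |A| * (y * 1) := by
    rw [abs_mul, abs_mul, abs_of_nonneg (by linarith : 0 ≤ y)]
    gcongr
    exact abs_le.2 ⟨by linarith, by linarith⟩
  rw [h1]
  refine (abs_add_le _ _).trans ((add_le_add hFb h2).trans ?_)
  have : 0 ≤ |A| * y := by positivity
  linarith

end SelbergInequality

theorem selberg_integral_inequality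
    (f : ℝ → ℝ) (A B C : ℝ)
    (hnonneg : ∀ x, 1 ≤ x → 0 ≤ f x)
    (hmono : ∀ x y, 1 ≤ x → x ≤ y → f x ≤ f y)
    (hF : (fun x : ℝ =>
        (∑ n ∈ Finset.Icc 1 ⌊x⌋₊, f (x / n)) -
          (A * x * Real.log x + B * x + C * x / Real.log x))
      =o[atTop] fun x : ℝ => x / Real.log x) :
    ∀ ε > (0:ℝ), ∃ X : ℝ, ∀ x, X ≤ x →
      |f x - A * x| / x ≤
        (1 / Real.log x) * (∫ t in (1:ℝ)..x, |f t - A * t| / t ^ 2) + ε := by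
  have hr := isSublinear_of_asymptotic hnonneg hmono hF
  obtain ⟨L, hL0, hL⟩ := exists_le_mul_of_isSublinear hnonneg hmono hr
  have hselberg := isSublinearLog_log_mul_add_vonMangoldt hr
  have hzeta := isSublinearLog_dirichletSum_zeta hnonneg hL hr
  set g : ℝ → ℝ := fun y ↦ f y - A * y with hg
  let v : ℝ → ℝ := fun y ↦ f y + |A| * y
  have hv : ∀ x, 1 ≤ x → v x ≤ (L + |A|) * x := fun x hx ↦ by
    simp only [v]; linarith [hL x hx]
  have hgv : ∀ x, 1 ≤ x → |g x| ≤ v x := fun x hx ↦ by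
    refine (abs_sub _ _).trans (le_of_eq ?_)
    rw [abs_of_nonneg (hnonneg x hx), abs_mul, abs_of_nonneg (by linarith : 0 ≤ x)]
  have hgmono : ∀ x y, 1 ≤ x → x ≤ y → |g y - g x| ≤ v y - v x := fun x y hx hxy ↦ by
    have h1 : g y - g x = (f y - f x) - A * (y - x) := by simp only [hg]; ring
    rw [h1]
    refine (abs_sub _ _).trans (le_of_eq ?_)
    rw [abs_of_nonneg (sub_nonneg.2 (hmono x y hx hxy)), abs_mul,
      abs_of_nonneg (sub_nonneg.2 hxy)]
    ring
  have habsmono : ∀ x y, 1 ≤ x → x ≤ y → |(|g y| - |g x|)| ≤ v y - v x := fun x y hx hxy ↦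
    (abs_abs_sub_abs_le_abs_sub _ _).trans (hgmono x y hx hxy)
  have hint : ∀ a b, 1 ≤ a → a ≤ b →
      IntervalIntegrable (fun t ↦ |g t| / t ^ 2) MeasureTheory.volume a b := fun a b ha hab ↦ by
    have hf : IntervalIntegrable f MeasureTheory.volume a b := by
      refine MonotoneOn.intervalIntegrable fun s hs t ht hst ↦ hmono s t ?_ hst
      rw [Set.uIcc_of_le hab] at hs
      exact ha.trans hs.1
    have hg' : IntervalIntegrable g MeasureTheory.volume a b :=
      hf.sub (Continuous.intervalIntegrable (by fun_prop) a b)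
    simp only [div_eq_mul_inv]
    refine hg'.abs.mul_continuousOn fun t ht ↦ ContinuousAt.continuousWithinAt ?_
    rw [Set.uIcc_of_le hab] at ht
    have : t ^ 2 ≠ 0 := pow_ne_zero 2 (by linarith [ht.1])
    fun_prop (disch := assumption)
  have hw := isSublinearLog_dirichletSum_selbergWeight_sub hv hgv hgmono
  have hwabs := isSublinearLog_dirichletSum_selbergWeight_sub (u := fun x ↦ |g x|) hv
    (fun x hx ↦ by simpa using hgv x hx) habsmono
  intro ε hε
  obtain ⟨K₁, hK₁0, hK₁⟩ := ((hselberg.const_mul 2).add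
    ((hw.const_mul (-1)).add (hzeta.const_mul (-2)))) (ε / 2) (by positivity)
  obtain ⟨K₂, hK₂0, hK₂⟩ := hwabs (ε / 2) (by positivity)
  set K := K₁ + K₂ + 2 * (L + |A|)
  refine ⟨Real.exp (K / ε + 1), fun x hx ↦ ?_⟩
  have hx1 : 1 ≤ x := (Real.one_le_exp (by positivity)).trans hx
  have hx0 : 0 < x := by linarith
  have hlog : K / ε + 1 ≤ Real.log x := (Real.le_log_iff_exp_le hx0).2 hx
  have hlog0 : 0 < Real.log x := lt_of_lt_of_le (by positivity) hlog
  have hKlog : K * x ≤ ε * (x * Real.log x) := by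
    have h1 : K / ε ≤ Real.log x := by linarith
    rw [div_le_iff₀ hε] at h1
    nlinarith
  have hsplit : ∀ u : ℝ → ℝ, dirichletSum (fun n ↦ selbergWeight n - 2) u x =
      dirichletSum ArithmeticFunction.vonMangoldt u x +
      ∑ n ∈ Finset.Icc 1 ⌊x⌋₊, (ArithmeticFunction.vonMangoldt * ArithmeticFunction.vonMangoldt) n /
        Real.log n * u (x / n) -
      2 * ∑ n ∈ Finset.Icc 1 ⌊x⌋₊, u (x / n) := fun u ↦ by
    rw [dirichletSum, dirichletSum, Finset.mul_sum, ← Finset.sum_add_distrib,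
      ← Finset.sum_sub_distrib]
    refine Finset.sum_congr rfl fun n _ ↦ ?_
    rw [selbergWeight]
    ring
  have h1 := hK₁ x hx1
  have h2 := hK₂ x hx1
  have h3 := sum_le_integral_add (u := fun x ↦ |g x|) (fun x hx ↦ by simpa using hgv x hx)
    (fun x _ ↦ abs_nonneg _) habsmono hint hx1
  have h4 := hv x hx1
  beta_reduce at h1
  rw [hsplit, dirichletSum_zeta] at h1
  rw [hsplit] at h2
  have h5 : |dirichletSum ArithmeticFunction.vonMangoldt g x| ≤
      dirichletSum ArithmeticFunction.vonMangoldt (fun y ↦ |g y|) x :=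
    abs_dirichletSum_le (fun n ↦ (abs_of_nonneg ArithmeticFunction.vonMangoldt_nonneg).le)
      fun y _ ↦ le_rfl
  have h6 : |∑ n ∈ Finset.Icc 1 ⌊x⌋₊,
        (ArithmeticFunction.vonMangoldt * ArithmeticFunction.vonMangoldt) n /
        Real.log n * g (x / n)| ≤ ∑ n ∈ Finset.Icc 1 ⌊x⌋₊,
        (ArithmeticFunction.vonMangoldt * ArithmeticFunction.vonMangoldt) n /
        Real.log n * |g (x / n)| := by
    refine (Finset.abs_sum_le_sum_abs _ _).trans (Finset.sum_le_sum fun n _ ↦ ?_)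
    rw [abs_mul, abs_of_nonneg (div_nonneg (vonMangoldt_mul_self_nonneg n)
      (Real.log_natCast_nonneg n))]
  have h7 : Real.log x * |g x| ≤ x * (∫ t in (1:ℝ)..x, |g t| / t ^ 2) + ε * (x * Real.log x) := by
    rw [← abs_of_nonneg hlog0.le, ← abs_mul, abs_of_nonneg hlog0.le]
    rw [abs_le] at h1 h2 h5 h6 ⊢
    constructor <;> linarith
  change |g x| / x ≤ (1 / Real.log x) * (∫ t in (1:ℝ)..x, |g t| / t ^ 2) + ε
  rw [div_le_iff₀ hx0]
  have h8 : |g x| ≤ (x * (∫ t in (1:ℝ)..x, |g t| / t ^ 2) + ε * (x * Real.log x)) / Real.log x :=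
    (le_div_iff₀' hlog0).2 h7
  refine h8.trans (le_of_eq ?_)
  field_simp
end

section
/- As x → ∞, Σ_{n ≤ x} Σ_{d | n} μ(d)·log²(n/d) = 2·x·log x + O(x), where the outer sum runs over positive integers n ≤ x and the inner sum over positive divisors d of n. Equivalently (via Selberg's identity), Σ_{n ≤ x} Λ(n)·log n + Σ_{a,b ≥ 1, a·b ≤ x} Λ(a)·Λ(b) = 2·x·log x + O(x). -/
open Filter Real Finset ArithmeticFunction

theorem exists_abs_sub_le_of_abs_sub_le_sub {a h : ℕ → ℝ} (hh : Tendsto h atTop (nhds 0))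
    (hd : ∀ n, 1 ≤ n → |a (n + 1) - a n| ≤ h n - h (n + 1)) :
    ∃ c, ∀ n, 1 ≤ n → |a n - c| ≤ h n := by
  have up : ∀ n, 1 ≤ n → ∀ k, a (n + k) + h (n + k) ≤ a n + h n := by
    intro n hn k
    induction k with
    | zero => simp
    | succ k ih =>
      have := abs_le.1 (hd (n + k) (by omega))
      rw [← add_assoc]
      linarith
  have low : ∀ n, 1 ≤ n → ∀ k, a n - h n ≤ a (n + k) - h (n + k) := by
    intro n hn k
    induction k with
    | zero => simp
    | succ k ih =>
      have := abs_le.1 (hd (n + k) (by omega))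
      rw [← add_assoc]
      linarith
  have hanti : Antitone fun k => h (1 + k) := antitone_nat_of_succ_le fun k => by
    have := (abs_nonneg _).trans (hd (1 + k) (by omega))
    rw [← add_assoc]
    linarith
  have hlim : Tendsto (fun k => h (1 + k)) atTop (nhds 0) := by
    simpa only [add_comm 1] using (tendsto_add_atTop_iff_nat 1).2 hh
  have hmono : Monotone fun k => a (1 + k) - h (1 + k) := monotone_nat_of_le_succ fun k => by
    simpa [add_assoc] using low (1 + k) (by omega) 1
  have hbdd : BddAbove (Set.range fun k => a (1 + k) - h (1 + k)) := by
    refine ⟨a 1 + h 1, ?_⟩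
    rintro _ ⟨k, rfl⟩
    have h1 := up 1 le_rfl k
    have h2 := hanti.le_of_tendsto hlim k
    simp only at h2 ⊢
    linarith
  have hc := tendsto_atTop_ciSup hmono hbdd
  set c := ⨆ k, (a (1 + k) - h (1 + k))
  have hc' : Tendsto (fun k => a k - h k) atTop (nhds c) := by
    refine (tendsto_add_atTop_iff_nat 1).1 ?_
    simpa only [add_comm 1] using hc
  have hc2 : Tendsto (fun k => a k + h k) atTop (nhds c) := by
    have := hc'.add (hh.const_mul 2)
    simp only [mul_zero, add_zero] at this
    exact this.congr fun k => by ring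
  refine ⟨c, fun n hn => abs_le.2 ⟨?_, ?_⟩⟩
  · have : c ≤ a n + h n := le_of_tendsto hc2 <| eventually_atTop.2 ⟨n, fun m hm => by
      obtain ⟨k, rfl⟩ := Nat.exists_eq_add_of_le hm
      exact up n hn k⟩
    linarith
  · have : a n - h n ≤ c := ge_of_tendsto hc' <| eventually_atTop.2 ⟨n, fun m hm => by
      obtain ⟨k, rfl⟩ := Nat.exists_eq_add_of_le hm
      exact low n hn k⟩
    linarith

theorem sub_div_le_log_sub_log {s t : ℝ} (hs : 0 < s) (ht : 0 < t) :
    (t - s) / t ≤ Real.log t - Real.log s := by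
  have := Real.one_sub_inv_le_log_of_pos (div_pos ht hs)
  rw [Real.log_div ht.ne' hs.ne', inv_div] at this
  rwa [sub_div, div_self ht.ne']

theorem log_sub_log_le_sub_div {s t : ℝ} (hs : 0 < s) (ht : 0 < t) :
    Real.log t - Real.log s ≤ (t - s) / s := by
  have := Real.log_le_sub_one_of_pos (div_pos ht hs)
  rw [Real.log_div ht.ne' hs.ne'] at this
  rwa [sub_div, div_self hs.ne']

theorem log_succ_sub_log_bounds {n : ℕ} (hn : 1 ≤ n) :
    1 / ((n : ℝ) + 1) ≤ Real.log (n + 1) - Real.log n ∧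
      Real.log (n + 1) - Real.log n ≤ 1 / (n : ℝ) := by
  have h0 : (0 : ℝ) < n := by exact_mod_cast hn
  have h1 := sub_div_le_log_sub_log h0 (by linarith : (0 : ℝ) < n + 1)
  have h2 := log_sub_log_le_sub_div h0 (by linarith : (0 : ℝ) < n + 1)
  rw [add_sub_cancel_left] at h1 h2
  exact ⟨h1, h2⟩

theorem exists_abs_sum_inv_sub_log_le :
    ∃ c : ℝ, ∀ n : ℕ, 1 ≤ n →
      |(∑ k ∈ Ioc 0 n, 1 / (k : ℝ)) - Real.log n - c| ≤ 1 / (n : ℝ) := by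
  refine exists_abs_sub_le_of_abs_sub_le_sub
    (a := fun n => (∑ k ∈ Ioc 0 n, 1 / (k : ℝ)) - Real.log n)
    tendsto_one_div_atTop_nhds_zero_nat fun n hn => ?_
  obtain ⟨h1, h2⟩ := log_succ_sub_log_bounds hn
  rw [Finset.sum_Ioc_succ_top (Nat.zero_le n)]
  push_cast
  rw [abs_le]
  constructor <;> linarith

theorem exists_abs_sum_log_div_sub_le :
    ∃ c : ℝ, ∀ n : ℕ, 1 ≤ n →
      |(∑ k ∈ Ioc 0 n, Real.log k / (k : ℝ)) - Real.log n ^ 2 / 2 - c| ≤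
        (2 + Real.log n) / (n : ℝ) := by
  refine exists_abs_sub_le_of_abs_sub_le_sub
    (a := fun n => (∑ k ∈ Ioc 0 n, Real.log k / (k : ℝ)) - Real.log n ^ 2 / 2)
    (h := fun n => (2 + Real.log n) / (n : ℝ)) ?_ fun n hn => ?_
  · have h1 : Tendsto (fun x : ℝ => 2 / x + Real.log x / x) atTop (nhds (0 + 0)) := by
      refine (tendsto_const_nhds.div_atTop tendsto_id).add ?_
      exact Real.isLittleO_log_id_atTop.tendsto_div_nhds_zero
    rw [add_zero] at h1
    exact (h1.comp tendsto_natCast_atTop_atTop).congr fun n => by simp [add_div]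
  · obtain ⟨h1, h2⟩ := log_succ_sub_log_bounds hn
    have h0 : (1 : ℝ) ≤ n := by exact_mod_cast hn
    have hl : 0 ≤ Real.log n := Real.log_nonneg h0
    rw [Finset.sum_Ioc_succ_top (Nat.zero_le n)]
    push_cast
    set x : ℝ := (n : ℝ)
    obtain ⟨d, hd⟩ : ∃ d, Real.log (x + 1) = Real.log x + d := ⟨_, (add_sub_cancel _ _).symm⟩
    rw [hd, add_sub_cancel_left] at h1 h2
    rw [hd]
    set l := Real.log x
    have hx : 0 < x := by linarith
    rw [div_le_iff₀ (by linarith)] at h1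
    rw [le_div_iff₀ hx] at h2
    have hd0 : 0 ≤ d := by nlinarith
    have key : (2 + l) / x - (2 + (l + d)) / (x + 1) =
      (2 + l - d * x) / (x * (x + 1)) := by field_simp; ring
    have key2 : (∑ k ∈ Ioc 0 n, Real.log k / (k : ℝ)) + (l + d) / (x + 1) - (l + d) ^ 2 / 2 -
        ((∑ k ∈ Ioc 0 n, Real.log k / (k : ℝ)) - l ^ 2 / 2) =
      ((l + d) * x - (2 * l + d) / 2 * (d * x) * (x + 1)) / (x * (x + 1)) := by field_simp; ring
    rw [key, key2, abs_le, ← neg_div]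
    constructor
    · refine div_le_div_of_nonneg_right ?_ (by positivity)
      nlinarith [mul_nonneg hl hd0, mul_nonneg hl hx.le, mul_nonneg hl (sub_nonneg.2 h2),
          mul_nonneg hd0 (sub_nonneg.2 h2), mul_nonneg (mul_nonneg hl hx.le) (sub_nonneg.2 h2),
          mul_nonneg (mul_nonneg hd0 hx.le) (sub_nonneg.2 h2)]
    · refine div_le_div_of_nonneg_right ?_ (by positivity)
      nlinarith [mul_nonneg hl hd0, mul_nonneg hl hx.le, mul_nonneg hl (sub_nonneg.2 h1),
          mul_nonneg hd0 (sub_nonneg.2 h1), mul_nonneg (mul_nonneg hl hx.le) (sub_nonneg.2 h1),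
          mul_nonneg (mul_nonneg hd0 hx.le) (sub_nonneg.2 h1)]

theorem abs_sum_log_sq_sub_le {n : ℕ} (hn : 1 ≤ n) :
    |(∑ k ∈ Ioc 0 n, Real.log k ^ 2) -
        (n * Real.log n ^ 2 - 2 * n * Real.log n + 2 * n)| ≤
      Real.log n ^ 2 + Real.log n + 2 := by
  induction n, hn using Nat.le_induction with
  | base => simp
  | succ n hn ih =>
    obtain ⟨h1, h2⟩ := log_succ_sub_log_bounds hn
    have h0 : (1 : ℝ) ≤ n := by exact_mod_cast hn
    have hl : 0 ≤ Real.log n := Real.log_nonneg h0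
    rw [Finset.sum_Ioc_succ_top (Nat.zero_le n)]
    push_cast
    set x : ℝ := (n : ℝ)
    obtain ⟨d, hd⟩ : ∃ d, Real.log (x + 1) = Real.log x + d := ⟨_, (add_sub_cancel _ _).symm⟩
    rw [hd, add_sub_cancel_left] at h1 h2
    rw [hd]
    set l := Real.log x
    rw [div_le_iff₀ (by linarith)] at h1
    rw [le_div_iff₀ (by linarith)] at h2
    have hd0 : 0 ≤ d := by nlinarith
    rw [abs_le] at ih ⊢
    have e1 := mul_nonneg hl (sub_nonneg.2 h1)
    have e2 := mul_nonneg hl (sub_nonneg.2 h2)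
    have e3 := mul_nonneg hd0 (sub_nonneg.2 h1)
    have e4 := mul_nonneg hd0 (sub_nonneg.2 h2)
    constructor <;> nlinarith

theorem one_add_log_sq_le {y : ℝ} (hy : 1 ≤ y) : (1 + Real.log y) ^ 2 ≤ 25 * √y := by
  have h0 : 0 ≤ Real.log y := Real.log_nonneg hy
  have hs : 1 ≤ √y := Real.one_le_sqrt.2 hy
  have ht : 1 ≤ √√y := Real.one_le_sqrt.2 hs
  have h1 : Real.log y = 4 * Real.log √√y := by
    rw [Real.log_sqrt (by positivity), Real.log_sqrt (by positivity)]
    ring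
  have h2 := Real.log_le_sub_one_of_pos (by positivity : 0 < √√y)
  have h3 := Real.sq_sqrt (by positivity : 0 ≤ √y)
  nlinarith

theorem floor_log_bounds {y : ℝ} (hy : 1 ≤ y) :
    1 ≤ ⌊y⌋₊ ∧ (⌊y⌋₊ : ℝ) ≤ y ∧ y ≤ ⌊y⌋₊ + 1 ∧ 0 ≤ Real.log ⌊y⌋₊ ∧
      Real.log ⌊y⌋₊ ≤ Real.log y ∧ ⌊y⌋₊ * (Real.log y - Real.log ⌊y⌋₊) ≤ 1 := by
  have h1 : 1 ≤ ⌊y⌋₊ := (Nat.one_le_floor_iff y).2 hy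
  have h1' : (1 : ℝ) ≤ ⌊y⌋₊ := by exact_mod_cast h1
  have h2 := Nat.floor_le (by linarith : 0 ≤ y)
  have h3 := (Nat.lt_floor_add_one y).le
  refine ⟨h1, h2, h3, Real.log_nonneg h1', Real.log_le_log (by linarith) h2, ?_⟩
  have h4 := log_sub_log_le_sub_div (by linarith : (0 : ℝ) < ⌊y⌋₊) (by linarith : 0 < y)
  rw [le_div_iff₀ (by linarith)] at h4
  linarith

theorem exists_abs_mul_sum_inv_floor_sub_le :
    ∃ c : ℝ, ∀ y : ℝ, 1 ≤ y →
      |y * (∑ k ∈ Ioc 0 ⌊y⌋₊, 1 / (k : ℝ)) - y * (Real.log y + c)| ≤ 4 := by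
  obtain ⟨c, hc⟩ := exists_abs_sum_inv_sub_log_le
  refine ⟨c, fun y hy => ?_⟩
  obtain ⟨h1, h2, h3, h4, h5, h6⟩ := floor_log_bounds hy
  have h := hc _ h1
  have h1' : (1 : ℝ) ≤ ⌊y⌋₊ := by exact_mod_cast h1
  set N : ℝ := (⌊y⌋₊ : ℝ)
  set H := ∑ k ∈ Ioc 0 ⌊y⌋₊, 1 / (k : ℝ)
  rw [le_div_iff₀ (by linarith)] at h
  have hb : |H - Real.log y - c| * N ≤ 2 := by
    have : |H - Real.log y - c| ≤ |H - Real.log N - c| + |Real.log y - Real.log N| := by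
      convert norm_sub_le (H - Real.log N - c) (Real.log y - Real.log N) using 1
      · rw [Real.norm_eq_abs]
        congr 1
        ring
      · simp only [Real.norm_eq_abs]
    rw [abs_of_nonneg (sub_nonneg.2 h5)] at this
    nlinarith
  rw [show y * H - y * (Real.log y + c) = y * (H - Real.log y - c) by ring, abs_mul,
    abs_of_nonneg (by linarith : 0 ≤ y)]
  nlinarith [abs_nonneg (H - Real.log y - c)]

theorem exists_abs_mul_sum_log_div_floor_sub_le :
    ∃ c : ℝ, ∀ y : ℝ, 1 ≤ y →
      |y * (∑ k ∈ Ioc 0 ⌊y⌋₊, Real.log k / (k : ℝ)) - y * (Real.log y ^ 2 / 2 + c)| ≤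
        4 * (1 + Real.log y) := by
  obtain ⟨c, hc⟩ := exists_abs_sum_log_div_sub_le
  refine ⟨c, fun y hy => ?_⟩
  obtain ⟨h1, h2, h3, h4, h5, h6⟩ := floor_log_bounds hy
  have h := hc _ h1
  have h1' : (1 : ℝ) ≤ ⌊y⌋₊ := by exact_mod_cast h1
  set N : ℝ := (⌊y⌋₊ : ℝ)
  set H := ∑ k ∈ Ioc 0 ⌊y⌋₊, Real.log k / (k : ℝ)
  rw [le_div_iff₀ (by linarith)] at h
  have hb : |H - Real.log y ^ 2 / 2 - c| * N ≤ 2 + 2 * Real.log y := by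
    have : |H - Real.log y ^ 2 / 2 - c| ≤
        |H - Real.log N ^ 2 / 2 - c| +
          |(Real.log y + Real.log N) / 2 * (Real.log y - Real.log N)| := by
      convert norm_sub_le (H - Real.log N ^ 2 / 2 - c)
        ((Real.log y + Real.log N) / 2 * (Real.log y - Real.log N)) using 1
      · rw [Real.norm_eq_abs]
        congr 1
        ring
      · simp only [Real.norm_eq_abs]
    rw [abs_of_nonneg (mul_nonneg (by linarith) (sub_nonneg.2 h5))] at this
    nlinarith [mul_le_mul_of_nonneg_left h6 (by linarith : 0 ≤ (Real.log y + Real.log N) / 2)]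
  rw [show y * H - y * (Real.log y ^ 2 / 2 + c) = y * (H - Real.log y ^ 2 / 2 - c) by ring,
    abs_mul, abs_of_nonneg (by linarith : 0 ≤ y)]
  nlinarith [abs_nonneg (H - Real.log y ^ 2 / 2 - c)]

theorem abs_sum_log_sq_floor_sub_le {y : ℝ} (hy : 1 ≤ y) :
    |(∑ k ∈ Ioc 0 ⌊y⌋₊, Real.log k ^ 2) -
        (y * Real.log y ^ 2 - 2 * y * Real.log y + 2 * y)| ≤ 6 * (1 + Real.log y) ^ 2 := by
  obtain ⟨h1, h2, h3, h4, h5, h6⟩ := floor_log_bounds hy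
  have h := abs_sum_log_sq_sub_le h1
  have h1' : (1 : ℝ) ≤ ⌊y⌋₊ := by exact_mod_cast h1
  set N : ℝ := (⌊y⌋₊ : ℝ)
  set m := Real.log N
  set l := Real.log y
  have e1 := mul_le_mul_of_nonneg_left h6 (by linarith : 0 ≤ l + m)
  have e2 : 0 ≤ (l + m) * (N * (l - m)) :=
    mul_nonneg (by linarith) (mul_nonneg (by linarith) (by linarith))
  have e3 : 0 ≤ N * (l - m) := mul_nonneg (by linarith) (by linarith)
  have e4 : 0 ≤ (y - N) * ((l - 1) ^ 2 + 1) := mul_nonneg (by linarith) (by positivity)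
  have e5 : (y - N) * ((l - 1) ^ 2 + 1) ≤ 1 * ((l - 1) ^ 2 + 1) :=
    mul_le_mul_of_nonneg_right (by linarith) (by positivity)
  have e6 : m ^ 2 ≤ l ^ 2 := by gcongr
  rw [abs_le] at h ⊢
  constructor <;> nlinarith

theorem exists_abs_sum_log_sq_sub_sum_le :
    ∃ c K C : ℝ, ∀ y : ℝ, 1 ≤ y →
      |(∑ k ∈ Ioc 0 ⌊y⌋₊, Real.log k ^ 2) -
        ∑ k ∈ Ioc 0 ⌊y⌋₊, (2 * (y / k) * Real.log (y / k) + c * (y / k) + K)| ≤ C * √y := by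
  obtain ⟨γ, hγ⟩ := exists_abs_mul_sum_inv_floor_sub_le
  obtain ⟨δ, hδ⟩ := exists_abs_mul_sum_log_div_floor_sub_le
  set c := -2 - 2 * γ with hc
  set K := 2 + 2 * δ - c * γ with hK
  refine ⟨c, K, 25 * (22 + 4 * |c| + |K|), fun y hy => ?_⟩
  obtain ⟨-, h2, h3, -, -, -⟩ := floor_log_bounds hy
  have hy0 : 0 < y := by linarith
  have hl : 0 ≤ Real.log y := Real.log_nonneg hy
  have b1 := hγ y hy
  have b2 := hδ y hy
  have b3 := abs_sum_log_sq_floor_sub_le hy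
  have b4 := one_add_log_sq_le hy
  have hsum : ∑ k ∈ Ioc 0 ⌊y⌋₊, (2 * (y / k) * Real.log (y / k) + c * (y / k) + K) =
      (2 * Real.log y + c) * (y * ∑ k ∈ Ioc 0 ⌊y⌋₊, 1 / (k : ℝ)) -
        2 * (y * ∑ k ∈ Ioc 0 ⌊y⌋₊, Real.log k / (k : ℝ)) + K * ⌊y⌋₊ := by
    have : K * (⌊y⌋₊ : ℝ) = ∑ k ∈ Ioc 0 ⌊y⌋₊, K := by simp [mul_comm]
    rw [this]
    simp only [Finset.mul_sum, ← Finset.sum_sub_distrib, ← Finset.sum_add_distrib]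
    refine Finset.sum_congr rfl fun k hk => ?_
    have hk0 : (k : ℝ) ≠ 0 := by exact_mod_cast (Finset.mem_Ioc.1 hk).1.ne'
    rw [Real.log_div hy0.ne' hk0]
    ring
  rw [hsum]
  set L := ∑ k ∈ Ioc 0 ⌊y⌋₊, Real.log k ^ 2
  set A := y * ∑ k ∈ Ioc 0 ⌊y⌋₊, 1 / (k : ℝ)
  set B := y * ∑ k ∈ Ioc 0 ⌊y⌋₊, Real.log k / (k : ℝ)
  set N : ℝ := (⌊y⌋₊ : ℝ)
  set l := Real.log y
  have split : L - ((2 * l + c) * A - 2 * B + K * N) =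
      (L - (y * l ^ 2 - 2 * y * l + 2 * y)) + -((2 * l) * (A - y * (l + γ))) +
        -(c * (A - y * (l + γ))) + 2 * (B - y * (l ^ 2 / 2 + δ)) + K * (y - N) := by
    rw [hK, hc]; ring
  have i1 : |(2 * l) * (A - y * (l + γ))| ≤ 2 * l * 4 := by
    rw [abs_mul, abs_of_nonneg (by positivity : 0 ≤ 2 * l)]
    gcongr
  have i2 : |c * (A - y * (l + γ))| ≤ |c| * 4 := by
    rw [abs_mul]; gcongr
  have i3 : |2 * (B - y * (l ^ 2 / 2 + δ))| ≤ 2 * (4 * (1 + l)) := by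
    rw [abs_mul, abs_two]; gcongr
  have i4 : |K * (y - N)| ≤ |K| * 1 := by
    rw [abs_mul, abs_of_nonneg (by linarith : 0 ≤ y - N)]
    gcongr
    linarith
  rw [split]
  have tri := (abs_add_le _ _).trans (add_le_add_left ((abs_add_le _ _).trans
    (add_le_add_left ((abs_add_le _ _).trans (add_le_add_left (abs_add_le
    (L - (y * l ^ 2 - 2 * y * l + 2 * y)) (-((2 * l) * (A - y * (l + γ)))))
    |-(c * (A - y * (l + γ)))|)) |2 * (B - y * (l ^ 2 / 2 + δ))|)) |K * (y - N)|)
  rw [abs_neg, abs_neg] at tri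
  refine tri.trans ?_
  have one_le : 1 + l ≤ (1 + l) ^ 2 := by nlinarith
  have q1 := mul_le_mul_of_nonneg_left b4 (abs_nonneg c)
  have q2 := mul_le_mul_of_nonneg_left b4 (abs_nonneg K)
  have q3 := mul_le_mul_of_nonneg_left one_le (abs_nonneg c)
  have q4 := mul_le_mul_of_nonneg_left one_le (abs_nonneg K)
  have q5 := mul_nonneg (abs_nonneg c) hl
  have q6 := mul_nonneg (abs_nonneg K) hl
  linarith

theorem sum_Ioc_sum_divisorsAntidiagonal {R : Type*} [AddCommMonoid R] (φ : ℕ → ℕ → R) (N : ℕ) :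
    ∑ n ∈ Ioc 0 N, ∑ p ∈ n.divisorsAntidiagonal, φ p.1 p.2 =
      ∑ d ∈ Ioc 0 N, ∑ m ∈ Ioc 0 (N / d), φ d m := by
  rw [Finset.sum_sigma', Finset.sum_sigma']
  refine Finset.sum_bij' (fun a _ => ⟨a.2.1, a.2.2⟩) (fun a _ => ⟨a.1 * a.2, (a.1, a.2)⟩)
    ?_ ?_ ?_ ?_ ?_
  · rintro ⟨n, d, m⟩ h
    simp only [mem_sigma, Finset.mem_Ioc, Nat.mem_divisorsAntidiagonal] at h ⊢
    obtain ⟨⟨h1, h2⟩, rfl, h3⟩ := h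
    have hd : 0 < d := Nat.pos_of_ne_zero (left_ne_zero_of_mul h3)
    have hm : 0 < m := Nat.pos_of_ne_zero (right_ne_zero_of_mul h3)
    exact ⟨⟨hd, (Nat.le_mul_of_pos_right d hm).trans h2⟩, hm,
      (Nat.le_div_iff_mul_le hd).2 (by rwa [mul_comm])⟩
  · rintro ⟨d, m⟩ h
    simp only [mem_sigma, Finset.mem_Ioc, Nat.mem_divisorsAntidiagonal] at h ⊢
    obtain ⟨⟨hd, -⟩, hm, h2⟩ := h
    rw [Nat.le_div_iff_mul_le hd, mul_comm] at h2
    exact ⟨⟨Nat.mul_pos hd hm, h2⟩, trivial, (Nat.mul_pos hd hm).ne'⟩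
  · rintro ⟨n, d, m⟩ h
    simp only [mem_sigma, Finset.mem_Ioc, Nat.mem_divisorsAntidiagonal] at h
    obtain ⟨-, rfl, -⟩ := h
    rfl
  · intros; rfl
  · intros; rfl

theorem sum_moebius_mul_sum_eq (F : ℕ → ℝ) {N : ℕ} (hN : 1 ≤ N) :
    ∑ d ∈ Ioc 0 N, (moebius d : ℝ) * ∑ m ∈ Ioc 0 (N / d), F (d * m) = F 1 := by
  simp only [Finset.mul_sum]
  rw [← sum_Ioc_sum_divisorsAntidiagonal fun d m => (moebius d : ℝ) * F (d * m)]
  have h : ∀ n ∈ Ioc 0 N, ∑ p ∈ n.divisorsAntidiagonal, (moebius p.1 : ℝ) * F (p.1 * p.2) =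
      if n = 1 then F 1 else 0 := by
    intro n hn
    have e : ∑ p ∈ n.divisorsAntidiagonal, (moebius p.1 : ℝ) * F (p.1 * p.2) =
        ((moebius : ArithmeticFunction ℝ) * (zeta : ArithmeticFunction ℝ)) n * F n := by
      rw [ArithmeticFunction.mul_apply, Finset.sum_mul]
      refine Finset.sum_congr rfl fun p hp => ?_
      have hp' := Nat.mem_divisorsAntidiagonal.1 hp
      rw [hp'.1]
      simp [right_ne_zero_of_mul (hp'.1.trans_ne hp'.2)]
    rw [e, coe_moebius_mul_coe_zeta, ArithmeticFunction.one_apply]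
    split_ifs with h1 <;> simp [h1]
  rw [Finset.sum_congr rfl h, Finset.sum_ite_eq']
  simp [hN]

theorem sum_one_div_sqrt_le (N : ℕ) : ∑ d ∈ Ioc 0 N, 1 / √(d : ℝ) ≤ 2 * √N := by
  induction N with
  | zero => simp
  | succ n ih =>
    rw [Finset.sum_Ioc_succ_top (Nat.zero_le n)]
    push_cast
    have hs : 0 < √((n : ℝ) + 1) := by positivity
    have h1 := Real.sq_sqrt (by positivity : 0 ≤ (n : ℝ) + 1)
    have h2 := Real.sq_sqrt (Nat.cast_nonneg (α := ℝ) n)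
    have : 1 / √((n : ℝ) + 1) ≤ 2 * √((n : ℝ) + 1) - 2 * √n := by
      rw [div_le_iff₀ hs]
      nlinarith [sq_nonneg (√((n : ℝ) + 1) - √n)]
    linarith

theorem exists_abs_sum_moebius_mul_log_sq_sub_le :
    ∃ c K C : ℝ, ∀ x : ℝ, 1 ≤ x →
      |(∑ n ∈ Ioc 0 ⌊x⌋₊, ∑ p ∈ n.divisorsAntidiagonal,
          (moebius p.1 : ℝ) * Real.log (p.2 : ℝ) ^ 2) -
        (2 * x * Real.log x + c * x + K)| ≤ C * x := by
  obtain ⟨c, K, C, hC⟩ := exists_abs_sum_log_sq_sub_sum_le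
  refine ⟨c, K, 2 * C, fun x hx => ?_⟩
  have hC0 : 0 ≤ C := by simpa using (abs_nonneg _).trans (hC 1 le_rfl)
  have hN : 1 ≤ ⌊x⌋₊ := (Nat.one_le_floor_iff x).2 hx
  have hinv := sum_moebius_mul_sum_eq
    (fun n => 2 * (x / n) * Real.log (x / n) + c * (x / n) + K) hN
  simp only [Nat.cast_one, div_one] at hinv
  rw [sum_Ioc_sum_divisorsAntidiagonal fun d m => (moebius d : ℝ) * Real.log (m : ℝ) ^ 2, ← hinv]
  simp only [← Finset.mul_sum, ← Finset.sum_sub_distrib, ← mul_sub]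
  refine (Finset.abs_sum_le_sum_abs _ _).trans ?_
  have hterm : ∀ d ∈ Ioc 0 ⌊x⌋₊, |(moebius d : ℝ) * ((∑ m ∈ Ioc 0 (⌊x⌋₊ / d),
      (Real.log (m : ℝ) ^ 2 - (2 * (x / ((d * m : ℕ) : ℝ)) * Real.log (x / ((d * m : ℕ) : ℝ)) +
        c * (x / ((d * m : ℕ) : ℝ)) + K))))| ≤ C * √x * (1 / √(d : ℝ)) := by
    intro d hd
    obtain ⟨hd0, hd1⟩ := Finset.mem_Ioc.1 hd
    have hd0' : (0 : ℝ) < d := by exact_mod_cast hd0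
    have hdx : (1 : ℝ) ≤ x / d := by
      rw [one_le_div hd0']
      exact (Nat.cast_le.2 hd1).trans (Nat.floor_le (by linarith))
    have h := hC _ hdx
    rw [Nat.floor_div_natCast, ← Finset.sum_sub_distrib, Real.sqrt_div (by linarith)] at h
    have hmu : |(moebius d : ℝ)| ≤ 1 := by exact_mod_cast abs_moebius_le_one (n := d)
    rw [abs_mul]
    simp only [Nat.cast_mul, ← div_div]
    calc _ ≤ 1 * (C * (√x / √(d : ℝ))) := by gcongr
      _ = _ := by ring
  refine (Finset.sum_le_sum hterm).trans ?_
  rw [← Finset.mul_sum]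
  have h1 : √(⌊x⌋₊ : ℝ) ≤ √x := Real.sqrt_le_sqrt (Nat.floor_le (by linarith))
  calc C * √x * ∑ d ∈ Ioc 0 ⌊x⌋₊, 1 / √(d : ℝ) ≤ C * √x * (2 * √x) := by
        gcongr
        exact (sum_one_div_sqrt_le _).trans (by gcongr)
    _ = 2 * C * √x ^ 2 := by ring
    _ = 2 * C * x := by rw [Real.sq_sqrt (by linarith)]

/-- The Selberg identity: `μ * log² = Λ log + Λ * Λ`. -/
theorem sum_moebius_mul_log_sq_eq (n : ℕ) :
    ∑ p ∈ n.divisorsAntidiagonal, (moebius p.1 : ℝ) * Real.log (p.2 : ℝ) ^ 2 =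
      Λ n * Real.log n + ∑ p ∈ n.divisorsAntidiagonal, Λ p.1 * Λ p.2 := by
  let T : ArithmeticFunction ℝ := vonMangoldt.pmul ArithmeticFunction.log + Λ * Λ
  let Q : ArithmeticFunction ℝ := ArithmeticFunction.log.pmul ArithmeticFunction.log
  have hTQ : T * (zeta : ArithmeticFunction ℝ) = Q := by
    rw [add_mul, mul_assoc, vonMangoldt_mul_zeta]
    ext m
    rw [ArithmeticFunction.add_apply, ArithmeticFunction.mul_apply, ArithmeticFunction.mul_apply,
      ← Finset.sum_add_distrib, pmul_apply]
    have hlog : ArithmeticFunction.log m = ∑ p ∈ m.divisorsAntidiagonal,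
        Λ p.1 * (zeta : ArithmeticFunction ℝ) p.2 := by
      rw [← vonMangoldt_mul_zeta, ArithmeticFunction.mul_apply]
    nth_rw 2 [hlog]
    rw [Finset.mul_sum]
    refine Finset.sum_congr rfl fun p hp => ?_
    obtain ⟨rfl, hp0⟩ := Nat.mem_divisorsAntidiagonal.1 hp
    have h1 := left_ne_zero_of_mul hp0
    have h2 := right_ne_zero_of_mul hp0
    simp only [pmul_apply, ArithmeticFunction.log_apply, natCoe_apply, zeta_apply, if_neg h2,
      Nat.cast_mul]
    rw [Real.log_mul (by exact_mod_cast h1) (by exact_mod_cast h2)]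
    push_cast
    ring
  have hT : (moebius : ArithmeticFunction ℝ) * Q = T := by
    rw [← hTQ, mul_comm T, ← mul_assoc, coe_moebius_mul_coe_zeta, one_mul]
  calc _ = ((moebius : ArithmeticFunction ℝ) * Q) n := by
        simp [ArithmeticFunction.mul_apply, Q, pmul_apply, sq]
    _ = _ := by
        rw [hT]
        simp [T, ArithmeticFunction.mul_apply, pmul_apply]

theorem selberg_sum_asymptotics :
    ((fun x : ℝ =>
        (∑ n ∈ Finset.Icc 1 ⌊x⌋₊, ∑ d ∈ n.divisors,
            (moebius d : ℝ) * (Real.log ((n / d : ℕ) : ℝ)) ^ 2)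
          - 2 * x * Real.log x)
      =O[atTop] fun x : ℝ => x) ∧
    ((fun x : ℝ =>
        ((∑ n ∈ Finset.Icc 1 ⌊x⌋₊, Λ n * Real.log n) +
          ∑ a ∈ Finset.Icc 1 ⌊x⌋₊, ∑ b ∈ Finset.Icc 1 (⌊x⌋₊ / a), Λ a * Λ b)
          - 2 * x * Real.log x)
      =O[atTop] fun x : ℝ => x) := by
  have main : (fun x : ℝ => (∑ n ∈ Ioc 0 ⌊x⌋₊, ∑ p ∈ n.divisorsAntidiagonal,
      (moebius p.1 : ℝ) * Real.log (p.2 : ℝ) ^ 2) - 2 * x * Real.log x)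
      =O[atTop] fun x : ℝ => x := by
    obtain ⟨c, K, C, h⟩ := exists_abs_sum_moebius_mul_log_sq_sub_le
    refine Asymptotics.IsBigO.of_bound (C + |c| + |K|) ?_
    filter_upwards [eventually_ge_atTop 1] with x hx
    have h1 := h x hx
    rw [Real.norm_eq_abs, Real.norm_of_nonneg (by linarith)]
    set S := ∑ n ∈ Ioc 0 ⌊x⌋₊, ∑ p ∈ n.divisorsAntidiagonal,
      (moebius p.1 : ℝ) * Real.log (p.2 : ℝ) ^ 2
    calc |S - 2 * x * Real.log x|
        = |(S - (2 * x * Real.log x + c * x + K)) + c * x + K| := by congr 1; ring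
      _ ≤ |S - (2 * x * Real.log x + c * x + K)| + |c * x| + |K| := abs_add_three _ _ _
      _ ≤ C * x + |c| * x + |K| * x := by
        rw [abs_mul, abs_of_nonneg (by linarith : 0 ≤ x)]
        gcongr
        exact le_mul_of_one_le_right (abs_nonneg K) hx
      _ = (C + |c| + |K|) * x := by ring
  have hIcc : ∀ N : ℕ, Finset.Icc 1 N = Ioc 0 N := fun N => rfl
  simp only [hIcc]
  constructor
  · refine main.congr_left fun x => ?_
    congr 1
    refine Finset.sum_congr rfl fun n _ => ?_
    exact Nat.sum_divisorsAntidiagonal fun d m => (moebius d : ℝ) * Real.log (m : ℝ) ^ 2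
  · refine main.congr_left fun x => ?_
    congr 1
    rw [← sum_Ioc_sum_divisorsAntidiagonal fun a b => Λ a * Λ b, ← Finset.sum_add_distrib]
    exact Finset.sum_congr rfl fun n _ => sum_moebius_mul_log_sq_eq n
end
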